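/- For every positive integer $n$, $\operatorname{spt}(5n+4) \equiv 0 \pmod 5$ — Andrews' congruence for the smallest parts function. -/

import Mathlib

/-- The smallest parts function. -/
def spt (n : ℕ) : ℕ :=
  ∑ P : Nat.Partition n, Multiset.card (P.parts.filter (fun a => ∀ b ∈ P.parts, a ≤ b))

section
open PowerSeries Filter Topology
open scoped PowerSeries.WithPiTopology

namespace Spt5

instance fact_prime_five : Fact (Nat.Prime 5) := ⟨by norm_num⟩

/-- Power series over the field with five elements. -/
abbrev A := PowerSeries (ZMod 5)

theorem tendsto_iff {ι : Type*} {l : Filter ι} {f : ι → A} {g : A} :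
    Tendsto f l (𝓝 g) ↔ ∀ M : ℕ, ∀ᶠ N in l, (X : A) ^ M ∣ f N - g := by
  rw [PowerSeries.WithPiTopology.tendsto_iff_coeff_tendsto]
  constructor
  · intro h M
    have h2 : ∀ d ∈ Finset.range M, ∀ᶠ N in l, coeff d (f N) = coeff d g := by
      intro d _
      have := h d
      rw [nhds_discrete, tendsto_pure] at this
      exact this
    rw [← Filter.eventually_all_finset] at h2
    filter_upwards [h2] with N hN
    rw [X_pow_dvd_iff]
    intro m hm
    rw [map_sub, hN m (Finset.mem_range.2 hm), sub_self]
  · intro h d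
    rw [nhds_discrete, tendsto_pure]
    filter_upwards [h (d+1)] with N hN
    rw [X_pow_dvd_iff] at hN
    have := hN d (Nat.lt_succ_self d)
    rwa [map_sub, sub_eq_zero] at this

theorem summable_of_dvd {ι : Type*} {f : ι → A} {b : ι → ℕ} (hb : Tendsto b cofinite atTop)
    (h : ∀ i, (X : A) ^ (b i) ∣ f i) : Summable f := by
  rw [PowerSeries.WithPiTopology.summable_iff_summable_coeff]
  intro d
  apply summable_of_hasFiniteSupport
  have hfin : {i | ¬ (d + 1 ≤ b i)}.Finite := by
    have := hb.eventually (eventually_ge_atTop (d+1))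
    exact this
  refine hfin.subset ?_
  intro i hi hlt
  apply hi
  exact (X_pow_dvd_iff.1 (h i)) d (by omega)

theorem tannery {ι : Type*} (s : ℕ → Finset ι) (hs : ∀ i, ∀ᶠ N in atTop, i ∈ s N)
    (w : ι → A) (b : ι → ℕ) (hb : Tendsto b cofinite atTop) (h : ∀ i, (X : A) ^ (b i) ∣ w i)
    (G : ℕ → ι → A) (G' : A) (hG : ∀ i, Tendsto (fun N => G N i) atTop (𝓝 G')) :
    Tendsto (fun N => ∑ i ∈ s N, w i * G N i) atTop (𝓝 ((∑' i, w i) * G')) := by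
  classical
  rw [tendsto_iff]
  intro M
  have hfin : {i | ¬ (M ≤ b i)}.Finite := by
    have := hb.eventually (eventually_ge_atTop M)
    exact this
  set T := hfin.toFinset with hT
  have hTm : ∀ i, i ∉ T → (X : A) ^ M ∣ w i := by
    intro i hi
    have : M ≤ b i := by
      by_contra hc
      exact hi (by simp [hT]; omega)
    exact (pow_dvd_pow _ this).trans (h i)
  have e1 : ∀ᶠ N in atTop, ∀ i ∈ T, i ∈ s N := by
    rw [Filter.eventually_all_finset]; intro i _; exact hs i
  have e2 : ∀ᶠ N in atTop, ∀ i ∈ T, (X : A) ^ M ∣ G N i - G' := by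
    rw [Filter.eventually_all_finset]; intro i _; exact tendsto_iff.1 (hG i) M
  have hsum : (X : A) ^ M ∣ (∑ i ∈ T, w i) - ∑' i, w i := by
    have hS := (summable_of_dvd hb h).hasSum
    have := (tendsto_iff.1 hS M)
    simp only [SummationFilter.unconditional_filter] at this
    obtain ⟨s0, hs0⟩ := eventually_atTop.1 this
    have h1 := hs0 (s0 ∪ T) (Finset.subset_union_left)
    have h2 : (X : A) ^ M ∣ ∑ i ∈ (s0 ∪ T) \ T, w i := by
      apply Finset.dvd_sum
      intro i hi
      exact hTm i (Finset.mem_sdiff.1 hi).2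
    have h3 := Finset.sum_sdiff (f := w) (Finset.subset_union_right : T ⊆ s0 ∪ T)
    have : (∑ i ∈ T, w i) - ∑' i, w i = ((∑ i ∈ s0 ∪ T, w i) - ∑' i, w i) - ∑ i ∈ (s0 ∪ T) \ T, w i := by
      rw [← h3]; ring
    rw [this]
    exact dvd_sub h1 h2
  filter_upwards [e1, e2] with N h1 h2
  have h3 := Finset.sum_sdiff (f := fun i => w i * G N i) (show T ⊆ s N from h1)
  have h4 : (X : A) ^ M ∣ ∑ i ∈ s N \ T, w i * G N i := by
    apply Finset.dvd_sum
    intro i hi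
    exact (hTm i (Finset.mem_sdiff.1 hi).2).mul_right _
  have h5 : (X : A) ^ M ∣ ∑ i ∈ T, w i * (G N i - G') := by
    apply Finset.dvd_sum
    intro i hi
    exact (h2 i hi).mul_left _
  have : ∑ i ∈ s N, w i * G N i - (∑' i, w i) * G' =
      ∑ i ∈ s N \ T, w i * G N i + ∑ i ∈ T, w i * (G N i - G')
       + ((∑ i ∈ T, w i) - ∑' i, w i) * G' := by
    rw [← h3]
    simp only [mul_sub, Finset.sum_sub_distrib, sub_mul, Finset.sum_mul]
    ring
  rw [this]
  exact dvd_add (dvd_add h4 h5) (hsum.mul_right _)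

theorem tendsto_inv' {ι : Type*} {l : Filter ι} {f : ι → A} {g : A} (h : Tendsto f l (𝓝 g))
    (hf : ∀ i, constantCoeff (f i) = 1) (hg : constantCoeff g = 1) :
    Tendsto (fun i => (f i)⁻¹) l (𝓝 g⁻¹) := by
  rw [tendsto_iff] at h ⊢
  intro M
  filter_upwards [h M] with N hN
  have h1 : f N * (f N)⁻¹ = 1 := PowerSeries.mul_inv_cancel _ (by simp [hf])
  have h2 : g * g⁻¹ = 1 := PowerSeries.mul_inv_cancel _ (by simp [hg])
  have : (f N)⁻¹ - g⁻¹ = (f N - g) * (-((f N)⁻¹ * g⁻¹)) := by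
    linear_combination (g⁻¹) * h1 - (f N)⁻¹ * h2
  rw [this]
  exact hN.mul_right _

/-- Finite products. -/
noncomputable def Pn (a c n : ℕ) : A := ∏ i ∈ Finset.range n, (1 - X ^ (a + c * i))

/-- Infinite products. -/
noncomputable def Pi' (a c : ℕ) : A := ∏' i : ℕ, (1 - X ^ (a + c * i))

theorem Pn_succ (a c n : ℕ) : Pn a c (n+1) = Pn a c n * (1 - X ^ (a + c * n)) := by
  simp [Pn, Finset.prod_range_succ]

theorem Pn_zero (a c : ℕ) : Pn a c 0 = 1 := by simp [Pn]

theorem multipliable_P (a c : ℕ) (hc : 0 < c) :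
    Multipliable (fun i : ℕ => (1 : A) - X ^ (a + c * i)) := by
  have := PowerSeries.WithPiTopology.multipliable_one_add_of_tendsto_order_atTop_nhds_top
    (R := ZMod 5) (f := fun i : ℕ => -((X : A) ^ (a + c * i))) ?_
  · simpa [sub_eq_add_neg] using this
  · refine ENat.tendsto_nhds_top_iff_natCast_lt.mpr (fun n ↦ Filter.eventually_atTop.mpr ⟨n+1, ?_⟩)
    intro m hm
    rw [order_neg, order_X_pow]
    norm_cast
    nlinarith

theorem tendsto_P (a c : ℕ) (hc : 0 < c) : Tendsto (Pn a c) atTop (𝓝 (Pi' a c)) :=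
  (multipliable_P a c hc).hasProd.tendsto_prod_nat

theorem cc_Pn (a c n : ℕ) (ha : 0 < a) : constantCoeff (Pn a c n) = 1 := by
  rw [Pn, map_prod]
  apply Finset.prod_eq_one
  intro i _
  have : a ≠ 0 := by omega
  simp [this]

theorem cc_of_tendsto {f : ℕ → A} {g : A} (h : Tendsto f atTop (𝓝 g))
    (hf : ∀ i, constantCoeff (f i) = 1) : constantCoeff g = 1 := by
  have := ((PowerSeries.WithPiTopology.continuous_constantCoeff (ZMod 5)).tendsto g).comp h
  refine tendsto_nhds_unique this ?_
  simp only [Function.comp_def, hf]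
  exact tendsto_const_nhds

theorem cc_P (a c : ℕ) (ha : 0 < a) (hc : 0 < c) : constantCoeff (Pi' a c) = 1 :=
  cc_of_tendsto (tendsto_P a c hc) (fun i => cc_Pn a c i ha)

theorem cc_ne {f : A} (h : constantCoeff f = 1) : f ≠ 0 := by
  rintro rfl; simp at h

/-- Support in a residue class. -/
def Sp (r : ZMod 5) (f : A) : Prop := ∀ n : ℕ, (n : ZMod 5) ≠ r → coeff n f = 0

theorem Sp.mul {r s : ZMod 5} {f g : A} (hf : Sp r f) (hg : Sp s g) : Sp (r + s) (f * g) := by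
  intro n hn
  rw [coeff_mul]
  apply Finset.sum_eq_zero
  intro p hp
  rw [Finset.HasAntidiagonal.mem_antidiagonal] at hp
  by_cases h1 : (p.1 : ZMod 5) = r
  · by_cases h2 : (p.2 : ZMod 5) = s
    · exfalso; apply hn; rw [← hp]; push_cast; rw [h1, h2]
    · rw [hg _ h2, mul_zero]
  · rw [hf _ h1, zero_mul]

theorem Sp_X (k : ℕ) : Sp k (X ^ k : A) := by
  intro n hn
  rw [coeff_X_pow, if_neg]
  rintro rfl; exact hn rfl

theorem Sp_pow5 (f : A) : Sp 0 (f ^ 5) := by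
  intro n hn
  have h : PowerSeries.derivative (ZMod 5) (f ^ 5) = 0 := by
    rw [Derivation.leibniz_pow]
    have : (5 : ℕ) • (f ^ 4 • PowerSeries.derivative (ZMod 5) f) = 0 := by
      rw [nsmul_eq_mul, show ((5 : ℕ) : A) = 0 from by
        have : ((5:ℕ) : ZMod 5) = 0 := by decide
        rw [← map_natCast (PowerSeries.C (R := ZMod 5)), this, map_zero], zero_mul]
    simpa using this
  rcases n with _ | n
  · simp at hn
  · have h2 := congrArg (coeff n) h
    rw [coeff_derivative] at h2
    simp only [map_zero, mul_eq_zero] at h2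
    rcases h2 with h2 | h2
    · exact h2
    · exfalso; apply hn; push_cast; exact h2

theorem Sp.add {r : ZMod 5} {f g : A} (hf : Sp r f) (hg : Sp r g) : Sp r (f + g) := by
  intro n hn; rw [map_add, hf n hn, hg n hn, add_zero]

theorem five_eq_zero : (5 : A) = 0 := by
  have : ((5:ℕ) : ZMod 5) = 0 := by decide
  have h : ((5 : ℕ) : A) = 0 := by
    rw [← map_natCast (PowerSeries.C (R := ZMod 5)), this, map_zero]
  exact_mod_cast h

theorem Sp_tsum {ι : Type*} {r : ZMod 5} {f : ι → A} {g : A} (h : HasSum f g) (hf : ∀ i, Sp r (f i)) :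
    Sp r g := by
  intro n hn
  rw [PowerSeries.WithPiTopology.hasSum_iff_hasSum_coeff] at h
  have := h n
  simp only [fun i => hf i n hn] at this
  exact (this.unique hasSum_zero)

end Spt5

namespace Spt5

/-- Weight counting one more than the multiplicity of `m`, parts at least `m`. -/
def f1 (m i c : ℕ) : ZMod 5 := if i < m then 0 else if i = m then (c : ZMod 5) + 1 else 1

/-- Weight of partitions with parts at least `m`. -/
def f2 (m i _c : ℕ) : ZMod 5 := if i < m then 0 else 1

theorem term_eq (m n : ℕ) (p : n.Partition) :
    p.parts.toFinsupp.prod (f1 m) - p.parts.toFinsupp.prod (f2 m) =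
      ((if ∀ b ∈ p.parts, m ≤ b then Multiset.count m p.parts else 0 : ℕ) : ZMod 5) := by
  classical
  simp only [Finsupp.prod, Multiset.toFinsupp_support, Multiset.toFinsupp_apply]
  split_ifs with h
  · have h2 : ∏ x ∈ p.parts.toFinset, f2 m x (Multiset.count x p.parts) = 1 := by
      apply Finset.prod_eq_one
      intro x hx
      have := h x (Multiset.mem_toFinset.1 hx)
      simp [f2, this]
    rw [h2]
    by_cases hm : m ∈ p.parts
    · rw [Finset.prod_eq_single_of_mem m (Multiset.mem_toFinset.2 hm)]
      · simp [f1]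
      · intro x hx hne
        have := h x (Multiset.mem_toFinset.1 hx)
        simp [f1, hne, this]
    · rw [Finset.prod_eq_one, Multiset.count_eq_zero_of_notMem hm]
      · simp
      · intro x hx
        have h3 := Multiset.mem_toFinset.1 hx
        have := h x h3
        have : x ≠ m := by rintro rfl; exact hm h3
        simp [f1, *]
  · push Not at h
    obtain ⟨b, hb, hlt⟩ := h
    rw [Finset.prod_eq_zero (Multiset.mem_toFinset.2 hb), Finset.prod_eq_zero (Multiset.mem_toFinset.2 hb)]
    · simp
    · simp [f2, hlt]
    · simp [f1, hlt]

/-- Partitions counted by copies of the smallest part `m`. -/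
noncomputable def Sm (m : ℕ) : A := Nat.Partition.genFun (f1 m) - Nat.Partition.genFun (f2 m)

theorem coeff_Sm (m n : ℕ) : coeff n (Sm m) =
    ∑ p : n.Partition, ((if ∀ b ∈ p.parts, m ≤ b then Multiset.count m p.parts else 0 : ℕ) : ZMod 5) := by
  rw [Sm, map_sub, Nat.Partition.coeff_genFun, Nat.Partition.coeff_genFun, ← Finset.sum_sub_distrib]
  exact Finset.sum_congr rfl (fun p _ => term_eq m n p)

/-- Generating function of `spt`. -/
noncomputable def sptS : A := PowerSeries.mk (fun n => (spt n : ZMod 5))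

theorem hasSum_sptS : HasSum (fun m : ℕ => Sm (m+1)) sptS := by
  classical
  rw [PowerSeries.WithPiTopology.hasSum_iff_hasSum_coeff]
  intro n
  have h : coeff n sptS = ∑ m ∈ Finset.range n, coeff n (Sm (m+1)) := by
    simp only [coeff_Sm, sptS, coeff_mk, spt]
    rw [Finset.sum_comm]
    push_cast
    apply Finset.sum_congr rfl
    intro p _
    rw [← Multiset.sum_count_eq_card (s := (Finset.range n).image (· + 1)), Finset.sum_image (by simp)]
    · push_cast
      apply Finset.sum_congr rfl
      intro m _
      rw [Multiset.count_filter]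
      push_cast
      rfl
    · intro a ha
      have ha := Multiset.mem_of_mem_filter ha
      have h1 := p.parts_pos ha
      have h2 : a ≤ n := by
        have := Multiset.single_le_sum (fun _ _ => Nat.zero_le _) a ha
        rwa [p.parts_sum] at this
      simp only [Finset.mem_image, Finset.mem_range]
      exact ⟨a - 1, by omega, by omega⟩
  rw [h]
  apply hasSum_sum_of_ne_finset_zero
  intro m hm
  rw [coeff_Sm]
  apply Finset.sum_eq_zero
  intro p _
  have : Multiset.count (m+1) p.parts = 0 := by
    rw [Multiset.count_eq_zero]
    intro ha
    have := Multiset.single_le_sum (fun _ _ => Nat.zero_le _) _ ha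
    rw [p.parts_sum] at this
    simp at hm
    omega
  simp [this]

/-- Euler product. -/
noncomputable def E : A := Pi' 1 1

/-- Finite Euler product. -/
noncomputable def qn (n : ℕ) : A := Pn 1 1 n

theorem qn_succ (n : ℕ) : qn (n+1) = qn n * (1 - X ^ (n+1)) := by
  rw [qn, Pn_succ, qn]; congr 3; ring

theorem cc_X (i : ℕ) : constantCoeff ((X : A) ^ (i+1)) = 0 := by simp

theorem cc_one_sub (i : ℕ) (hi : 0 < i) : constantCoeff (1 - (X : A) ^ i) = 1 := by
  have : i ≠ 0 := by omega
  simp [this]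

theorem inv_cancel {f : A} (h : constantCoeff f = 1) : f * f⁻¹ = 1 :=
  PowerSeries.mul_inv_cancel _ (by simp [h])

theorem eq_inv {f g : A} (h : constantCoeff f = 1) (hfg : f * g = 1) : g = f⁻¹ := by
  have := inv_cancel h
  exact mul_left_cancel₀ (cc_ne h) (hfg.trans this.symm)

theorem geom (i : ℕ) : HasSum (fun j : ℕ => ((X : A) ^ (i+1)) ^ j) (1 - X ^ (i+1))⁻¹ := by
  have h1 := PowerSeries.WithPiTopology.summable_pow_of_constantCoeff_eq_zero (cc_X i)
  have h2 := PowerSeries.WithPiTopology.one_sub_mul_tsum_pow_of_constantCoeff_eq_zero (cc_X i)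
  rw [← eq_inv (cc_one_sub _ (Nat.succ_pos i)) h2]
  exact h1.hasSum

theorem geom2 (i : ℕ) : HasSum (fun j : ℕ => ((j : A) + 1) * ((X : A) ^ (i+1)) ^ j)
    ((1 - X ^ (i+1))⁻¹ ^ 2) := by
  have hs : Summable (fun j : ℕ => ((j : A) + 1) * ((X : A) ^ (i+1)) ^ j) := by
    apply summable_of_dvd (b := fun j => j)
    · rw [Nat.cofinite_eq_atTop]; exact tendsto_id
    · intro j
      rw [← pow_mul]
      apply Dvd.dvd.mul_left
      apply pow_dvd_pow
      nlinarith
  have h1 := geom i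
  have h2 := h1.mul_left (X ^ (i+1))
  obtain ⟨D, hD⟩ := hs
  have h3 := (hD.mul_left (X ^ (i+1)))
  have h4 := (hasSum_nat_add_iff' 1).2 hD
  have h5 := h3.add h2
  have h6 : D - 1 = X ^ (i+1) * D + X ^ (i+1) * (1 - X ^ (i+1))⁻¹ := by
    have e : (fun n : ℕ => ((↑(n+1) : A) + 1) * ((X : A) ^ (i+1)) ^ (n+1)) =
        fun b : ℕ => X ^ (i+1) * (((b : A) + 1) * (X ^ (i+1)) ^ b) + X ^ (i+1) * (X ^ (i+1)) ^ b := by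
      funext j; push_cast; ring
    rw [e] at h4
    have := h4.unique h5
    simpa using this
  have h7 := inv_cancel (cc_one_sub (i+1) (Nat.succ_pos i))
  have : D = (1 - X ^ (i+1))⁻¹ ^ 2 := by
    apply mul_left_cancel₀ (cc_ne (cc_one_sub (i+1) (Nat.succ_pos i)))
    linear_combination h6 + (-1 - (1 - X ^ (i+1))⁻¹) * h7
  rwa [← this]

theorem fac_eq_zero (f : ℕ → ℕ → ZMod 5) (i : ℕ) (h : ∀ j, f (i+1) (j+1) = 0) :
    (1 + ∑' j, f (i + 1) (j + 1) • (X : A) ^ ((i + 1) * (j + 1))) = 1 := by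
  simp [h]

theorem fac_eq_one (f : ℕ → ℕ → ZMod 5) (i : ℕ) (h : ∀ j, f (i+1) (j+1) = 1) :
    (1 + ∑' j, f (i + 1) (j + 1) • (X : A) ^ ((i + 1) * (j + 1))) = (1 - X ^ (i+1))⁻¹ := by
  have h1 := (geom i)
  rw [← h1.tsum_eq, h1.summable.tsum_eq_zero_add]
  simp [h, pow_mul]

theorem fac_eq_two (f : ℕ → ℕ → ZMod 5) (i : ℕ) (h : ∀ j : ℕ, f (i+1) (j+1) = (j : ZMod 5) + 1 + 1) :
    (1 + ∑' j, f (i + 1) (j + 1) • (X : A) ^ ((i + 1) * (j + 1))) = (1 - X ^ (i+1))⁻¹ ^ 2 := by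
  have h1 := (geom2 i)
  rw [← h1.tsum_eq, h1.summable.tsum_eq_zero_add]
  simp [h, pow_mul, smul_eq_C_mul]

theorem E_mul_genFun (f : ℕ → ℕ → ZMod 5) (m : ℕ) (h0 : ∀ i j, i < m → f (i+1) (j+1) = 0)
    (h1 : ∀ i j, m < i → f (i+1) (j+1) = 1) :
    E * Nat.Partition.genFun f =
      qn (m+1) * (1 + ∑' j, f (m + 1) (j + 1) • (X : A) ^ ((m + 1) * (j + 1))) := by
  have hE : HasProd (fun i : ℕ => (1 : A) - X ^ (i+1)) E := by
    have := (multipliable_P 1 1 one_pos).hasProd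
    simpa [E, Pi', add_comm] using this
  have h2 := hE.mul (Nat.Partition.hasProd_genFun f)
  have h3 : ∀ i ∉ Finset.range (m+1), ((1 : A) - X ^ (i+1)) *
      (1 + ∑' j, f (i + 1) (j + 1) • (X : A) ^ ((i + 1) * (j + 1))) = 1 := by
    intro i hi
    simp only [Finset.mem_range] at hi
    rw [fac_eq_one f i (fun j => h1 i j (by omega))]
    exact inv_cancel (cc_one_sub _ (Nat.succ_pos i))
  rw [h2.unique (hasProd_prod_of_ne_finset_one h3), Finset.prod_range_succ, qn_succ, mul_assoc]
  congr 1
  rw [qn, Pn]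
  apply Finset.prod_congr rfl
  intro i hi
  simp only [Finset.mem_range] at hi
  rw [fac_eq_zero f i (fun j => h0 i j hi), mul_one]
  congr 2; ring

theorem E_mul_Sm (m : ℕ) : E * Sm (m+1) = X ^ (m+1) * qn m * (1 - X ^ (m+1))⁻¹ := by
  rw [Sm, mul_sub, E_mul_genFun (f1 (m+1)) m, E_mul_genFun (f2 (m+1)) m, fac_eq_two, fac_eq_one, qn_succ]
  · have h7 := inv_cancel (cc_one_sub (m+1) (Nat.succ_pos m))
    linear_combination qn m * ((1 - X ^ (m+1))⁻¹ - 1) * h7 + qn m * h7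
  · intro j; simp [f2]
  · intro j; simp [f1]
  · intro i j h; simp [f2, h]
  · intro i j h; simp [f2]; omega
  · intro i j h; simp [f1, h]
  · intro i j h; 
    have : ¬ (i < m) := by omega
    have : i ≠ m := by omega
    simp [f1, *]

theorem hasSum_ES : HasSum (fun m : ℕ => X ^ (m+1) * qn m * (1 - X ^ (m+1))⁻¹) (E * sptS) := by
  have := hasSum_sptS.mul_left E
  simpa only [E_mul_Sm] using this

end Spt5

namespace Spt5

/-- Inverse `q`-factorials, extended by zero. -/
noncomputable def ip (n : ℤ) : A := if n < 0 then 0 else (qn n.toNat)⁻¹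

theorem cc_qn (n : ℕ) : constantCoeff (qn n) = 1 := cc_Pn 1 1 n one_pos

theorem ip_neg {n : ℤ} (h : n < 0) : ip n = 0 := by simp [ip, h]

theorem ip_nat (n : ℕ) : ip n = (qn n)⁻¹ := by simp [ip]

theorem qn_zero : qn 0 = 1 := Pn_zero 1 1

theorem ip_pred (n : ℕ) {k l : ℤ} (hk : k = n) (hl : l = k - 1) : ip l = (1 - X ^ n) * ip k := by
  subst hk; subst hl
  rcases n with _ | n
  · rw [ip_neg]; simp; simp
  · have : ((n+1 : ℕ) : ℤ) - 1 = (n : ℕ) := by push_cast; ring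
    rw [this, ip_nat, ip_nat]
    symm
    apply eq_inv (cc_qn n)
    rw [← mul_assoc, ← qn_succ]
    exact inv_cancel (cc_qn _)

/-- Pentagonal exponents. -/
def pent (r : ℕ) : ℕ := r + 3 * r.choose 2

theorem pent_succ (r : ℕ) : pent (r+1) = pent r + 3 * r + 1 := by
  simp [pent, Nat.choose_succ_succ']; ring

theorem le_pent (r : ℕ) : r ≤ pent r := Nat.le_add_right _ _

/-- Bailey coefficients. -/
noncomputable def al (r : ℕ) : A := if r = 0 then 1 else (-1)^r * X ^ (pent r) * (1 + X ^ r)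

/-- Bailey summand. -/
noncomputable def FF (n r : ℕ) : A := al r * qn n * ip (n - r) * ip (n + r)

theorem FF_tele (n k : ℕ) (hk : k ≤ n + 1) : ∑ r ∈ Finset.range (k+1), (FF (n+1) r - FF n r) =
    (-1)^k * X ^ (pent k + 2 * k + n + 1) * qn n * ip (n - k) * ip (n + 1 + k) := by
  induction k with
  | zero =>
    simp only [zero_add, Finset.sum_range_one, FF, al, if_true, qn_succ, pent]
    have h1 : ip (n : ℤ) = (1 - X ^ (n+1)) * ip (n + 1 : ℤ) :=
      ip_pred (n+1) (by push_cast; ring) (by ring)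
    push_cast
    simp only [sub_zero, add_zero, h1, Nat.choose_zero_succ]
    ring
  | succ k ih =>
    rw [Finset.sum_range_succ, ih (by omega)]
    obtain ⟨a, rfl⟩ : ∃ a, n = a + k := ⟨n - k, by omega⟩
    have h1 : ip (((a + k : ℕ) : ℤ) - (k + 1 : ℕ)) = (1 - X ^ a) * ip (((a + k : ℕ) : ℤ) - k) :=
      ip_pred a (by push_cast; ring) (by push_cast; ring)
    have h2 : ip (((a + k : ℕ) : ℤ) + (k + 1 : ℕ)) =
        (1 - X ^ (a + k + 1 + (k + 1))) * ip (((a + k : ℕ) : ℤ) + 1 + (k + 1 : ℕ)) :=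
      ip_pred _ (by push_cast; ring) (by push_cast; ring)
    have h3 : ((a + k : ℕ) : ℤ) + 1 + k = ((a + k : ℕ) : ℤ) + (k + 1 : ℕ) := by push_cast; ring
    have h4 : ((a + k + 1 : ℕ) : ℤ) - (k + 1 : ℕ) = ((a + k : ℕ) : ℤ) - k := by push_cast; ring
    have h5 : ((a + k + 1 : ℕ) : ℤ) + (k + 1 : ℕ) = ((a + k : ℕ) : ℤ) + 1 + (k + 1 : ℕ) := by
      push_cast; ring
    simp only [FF, al, Nat.succ_ne_zero, if_false, h3, h4, h5, h1, h2, qn_succ, pent_succ]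
    ring

theorem FF_sum (n : ℕ) : ∑ r ∈ Finset.range (n+1), FF n r = 1 := by
  induction n with
  | zero => simp [FF, al, ip, qn_zero]
  | succ n ih =>
    have h := FF_tele n (n+1) le_rfl
    rw [Finset.sum_sub_distrib, Finset.sum_range_succ (fun r => FF n r), ih] at h
    have h0 : FF n (n+1) = 0 := by
      rw [FF, ip_neg (by push_cast; omega)]; ring
    rw [ip_neg (n := (n : ℤ) - ↑(n+1)) (by push_cast; omega), h0] at h
    linear_combination h

/-- The summand `t`. -/
noncomputable def tt (m r : ℕ) : A := X ^ (m+1) * qn m ^ 2 * ip (m + 1 - r) * ip (m + 1 + r)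

/-- The telescoping certificate. -/
noncomputable def GG (r m : ℕ) : A :=
  -((1 - X ^ (2*r+1)) * X ^ (m+1) * qn m ^ 2 * ip (m - r) * ip (m + 1 + r))

theorem tt_tele (m r : ℕ) : (1 - X ^ (r+1)) ^ 2 * tt m (r+1) - X * (1 - X ^ r) ^ 2 * tt m r
    = GG r (m+1) - GG r m := by
  have h0 : (m : ℤ) + 1 - (r + 1 : ℕ) = m - r := by push_cast; ring
  have h3 : ((m + 1 : ℕ) : ℤ) - r = m + 1 - r := by push_cast; ring
  have h4 : ((m + 1 : ℕ) : ℤ) + 1 + r = m + 1 + (r + 1 : ℕ) := by push_cast; ring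
  simp only [tt, GG, h0, h3, h4]
  by_cases h : m + 1 < r
  · rw [ip_neg (n := (m : ℤ) - r) (by omega), ip_neg (n := (m : ℤ) + 1 - r) (by omega)]
    ring
  · obtain ⟨a, ha⟩ : ∃ a, m + 1 = a + r := ⟨m + 1 - r, by omega⟩
    have h1 : ip ((m : ℤ) - r) = (1 - X ^ a) * ip (m + 1 - r) :=
      ip_pred a (by omega) (by ring)
    have h2 : ip ((m : ℤ) + 1 + r) = (1 - X ^ (a + r + r + 1)) * ip (m + 1 + (r + 1 : ℕ)) :=
      ip_pred _ (by push_cast; omega) (by push_cast; ring)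
    rw [h1, h2, qn_succ, ha]
    ring

theorem dvd_tt (m r : ℕ) : (X : A) ^ m ∣ tt m r := by
  rw [tt, pow_succ]
  exact ⟨X * qn m ^ 2 * ip (m + 1 - r) * ip (m + 1 + r), by ring⟩

theorem summable_tt (r : ℕ) : Summable (fun m => tt m r) :=
  summable_of_dvd (b := fun m => m) (by rw [Nat.cofinite_eq_atTop]; exact tendsto_id)
    (fun m => dvd_tt m r)

theorem GG_lim (r : ℕ) : Tendsto (GG r) atTop (𝓝 0) := by
  rw [tendsto_iff]
  intro M
  filter_upwards [eventually_ge_atTop M] with N hN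
  rw [sub_zero, GG]
  apply Dvd.dvd.trans (pow_dvd_pow _ (show M ≤ N + 1 by omega))
  exact ⟨-((1 - X ^ (2*r+1)) * qn N ^ 2 * ip (N - r) * ip (N + 1 + r)), by ring⟩

theorem TT_rec (r : ℕ) : (1 - X ^ (r+1)) ^ 2 * (∑' m, tt m (r+1)) - X * (1 - X ^ r) ^ 2 * (∑' m, tt m r)
    = - GG r 0 := by
  have h1 := (((summable_tt (r+1)).hasSum.mul_left ((1 - X ^ (r+1)) ^ 2)).sub
    ((summable_tt r).hasSum.mul_left (X * (1 - X ^ r) ^ 2))).tendsto_sum_nat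
  have h2 : Tendsto (fun n => GG r n - GG r 0) atTop (𝓝 (0 - GG r 0)) :=
    (GG_lim r).sub tendsto_const_nhds
  rw [zero_sub] at h2
  refine tendsto_nhds_unique h1 (h2.congr ?_)
  intro n
  simp only [tt_tele]
  rw [Finset.sum_range_sub]

theorem TT_eq (r : ℕ) : (1 - X ^ (r+1)) ^ 2 * (∑' m, tt m (r+1)) = X ^ (r+1) := by
  induction r with
  | zero =>
    have := TT_rec 0
    have h1 : ip 1 = (qn 1)⁻¹ := ip_nat 1
    have h3 : ip 0 = 1 := by simp [ip, qn_zero]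
    have h2 := inv_cancel (cc_qn 1)
    rw [← h1] at h2
    rw [qn_succ, qn_zero] at h2
    have e : GG 0 0 = -X := by
      simp only [GG, Nat.cast_zero, qn_zero, sub_zero, zero_add, add_zero, h3]
      linear_combination (-X) * h2
    rw [e] at this
    linear_combination this
  | succ r ih =>
    have := TT_rec (r+1)
    have e : GG (r+1) 0 = 0 := by
      rw [GG, ip_neg (n := ((0:ℕ) : ℤ) - ↑(r+1)) (by push_cast; omega)]
      ring
    rw [e] at this
    linear_combination this + X * ih

theorem TT_eq' (r : ℕ) : (∑' m, tt m (r+1)) = X ^ (r+1) * ((1 - X ^ (r+1))⁻¹) ^ 2 := by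
  have h := inv_cancel (cc_one_sub (r+1) (Nat.succ_pos r))
  have := TT_eq r
  set u := (1 - (X:A) ^ (r+1))⁻¹
  linear_combination u^2 * this - ((1 - (X:A) ^ (r+1)) * u + 1) * (∑' m, tt m (r+1)) * h

theorem tt_zero (m : ℕ) : tt m 0 = X ^ (m+1) * ((1 - X ^ (m+1))⁻¹) ^ 2 := by
  have h : (1 - X ^ (m+1)) * _ = (1 : A) := inv_cancel (cc_one_sub (m+1) (Nat.succ_pos m))
  have h1 : ip ((m : ℤ) + 1) = (qn (m+1))⁻¹ := by exact_mod_cast ip_nat (m+1)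
  have h2 := inv_cancel (cc_qn (m+1))
  rw [← h1, qn_succ] at h2
  simp only [tt, Nat.cast_zero, sub_zero, add_zero]
  have h3 : qn m * ip (m+1) = (1 - X ^ (m+1))⁻¹ := by
    apply eq_inv (cc_one_sub (m+1) (Nat.succ_pos m))
    linear_combination h2
  rw [← h3]; ring

theorem ES_term (m : ℕ) : HasSum (fun r => al r * tt m r) (X ^ (m+1) * qn m * (1 - X ^ (m+1))⁻¹) := by
  have h1 : ip ((m : ℤ) + 1) = (qn (m+1))⁻¹ := by exact_mod_cast ip_nat (m+1)
  have h2 := inv_cancel (cc_qn (m+1))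
  rw [← h1, qn_succ] at h2
  have h3 : qn m * ip (m+1) = (1 - X ^ (m+1))⁻¹ := by
    apply eq_inv (cc_one_sub (m+1) (Nat.succ_pos m))
    linear_combination h2
  have h4 : X ^ (m+1) * qn m * (1 - X ^ (m+1))⁻¹ = ∑ r ∈ Finset.range (m+1+1), al r * tt m r := by
    have h5 := FF_sum (m+1)
    rw [← h3]
    have h6 : ∑ r ∈ Finset.range (m+1+1), al r * tt m r =
        X ^ (m+1) * qn m ^ 2 * ip (m+1) * ∑ r ∈ Finset.range (m+1+1), FF (m+1) r := by
      rw [Finset.mul_sum]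
      apply Finset.sum_congr rfl
      intro r _
      simp only [FF, tt, qn_succ]
      push_cast
      linear_combination (-al r * X ^ (m+1) * qn m ^ 2 * ip (↑m + 1 - ↑r) * ip (↑m + 1 + ↑r)) * h2
    rw [h6, h5]; ring
  rw [h4]
  apply hasSum_sum_of_ne_finset_zero
  intro r hr
  rw [Finset.mem_range] at hr
  rw [tt, ip_neg (n := (m : ℤ) + 1 - r) (by omega)]
  ring

theorem dvd_al (r : ℕ) : (X : A) ^ r ∣ al r := by
  rw [al]
  split_ifs with h
  · subst h; simp
  · apply Dvd.dvd.mul_right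
    apply Dvd.dvd.mul_left
    exact pow_dvd_pow _ (le_pent r)

theorem tendsto_add_cofinite : Tendsto (fun p : ℕ × ℕ => p.1 + p.2) cofinite atTop := by
  rw [tendsto_atTop]
  intro b
  show {p : ℕ × ℕ | ¬ (b ≤ p.1 + p.2)}.Finite
  apply ((Set.finite_Iio b).prod (Set.finite_Iio b)).subset
  rintro ⟨x, y⟩ h
  simp at h ⊢
  omega

theorem summable_dbl : Summable (fun p : ℕ × ℕ => al p.2 * tt p.1 p.2) := by
  apply summable_of_dvd tendsto_add_cofinite
  rintro ⟨m, r⟩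
  rw [pow_add, mul_comm]
  exact mul_dvd_mul (dvd_al r) (dvd_tt m r)

theorem ES_swap : HasSum (fun r => al r * ∑' m, tt m r) (E * sptS) := by
  have h1 := summable_dbl.hasSum
  have h2 := h1.prod_fiberwise (fun m => ES_term m)
  rw [h2.unique hasSum_ES] at h1
  have h3 := (Equiv.prodComm ℕ ℕ).hasSum_iff.2 h1
  exact h3.prod_fiberwise (fun r => (summable_tt r).hasSum.mul_left (al r))

/-- The divisor sum series. -/
noncomputable def T0 : A := ∑' m, tt m 0

theorem hasSum_T0 : HasSum (fun m : ℕ => X ^ (m+1) * ((1 - X ^ (m+1))⁻¹) ^ 2) T0 := by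
  have := (summable_tt 0).hasSum
  simpa only [tt_zero, T0] using this

theorem ES_main : HasSum (fun r : ℕ => (-1)^(r+1) * X ^ (pent (r+1)) * (1 + X ^ (r+1)) *
    (X ^ (r+1) * ((1 - X ^ (r+1))⁻¹) ^ 2)) (E * sptS - T0) := by
  have h := (hasSum_nat_add_iff' 1).2 ES_swap
  simp only [TT_eq'] at h
  simpa [al, T0] using h

end Spt5

namespace Spt5

/-- Inverse factorials in base `X ^ c`. -/
noncomputable def ipc (c : ℕ) (n : ℤ) : A := if n < 0 then 0 else (Pn c c n.toNat)⁻¹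

theorem Pcc_succ (c n : ℕ) : Pn c c (n+1) = Pn c c n * (1 - (X ^ c) ^ (n+1)) := by
  rw [Pn_succ, ← pow_mul]; congr 3; ring

theorem ipc_neg (c : ℕ) {n : ℤ} (h : n < 0) : ipc c n = 0 := by simp [ipc, h]

theorem ipc_nat (c n : ℕ) : ipc c n = (Pn c c n)⁻¹ := by simp [ipc]

theorem ipc_pred {c : ℕ} (hc : 0 < c) (n : ℕ) {k l : ℤ} (hk : k = n) (hl : l = k - 1) :
    ipc c l = (1 - (X ^ c) ^ n) * ipc c k := by
  subst hk; subst hl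
  rcases n with _ | n
  · rw [ipc_neg]; simp; simp
  · have : ((n+1 : ℕ) : ℤ) - 1 = (n : ℕ) := by push_cast; ring
    rw [this, ipc_nat, ipc_nat]
    symm
    apply eq_inv (cc_Pn c c n hc)
    rw [← mul_assoc, ← Pcc_succ]
    exact inv_cancel (cc_Pn c c _ hc)

/-- Gaussian coefficient kernel. -/
noncomputable def ck (c N k : ℕ) : A := Pn c c (2*N+1) * ipc c (N - k) * ipc c (N + 1 + k)

theorem ck_diag {c : ℕ} (hc : 0 < c) (N : ℕ) : ck c N N = 1 := by
  have h : (N : ℤ) + 1 + N = ((2 * N + 1 : ℕ) : ℤ) := by push_cast; ring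
  have h0 : ipc c 0 = 1 := by simp [ipc, Pn_zero]
  rw [ck, h, sub_self, h0, ipc_nat, mul_one]
  exact inv_cancel (cc_Pn c c _ hc)

theorem ck_over (c N k : ℕ) (h : N < k) : ck c N k = 0 := by
  rw [ck, ipc_neg c (by omega)]; ring

theorem jtp_tele {c : ℕ} (hc : 0 < c) (C : ℕ → A) (μ : A) (h1 : C 1 = (μ + X ^ c) * C 0)
  (h2 : ∀ k, C (k+2) = μ * (X ^ c) ^ (k+1) * C (k+1) - (X ^ c) ^ (2*k+3) * C k)
    (N k : ℕ) (hk : k ≤ N) : ∑ j ∈ Finset.range (k+1), (-1)^j * C j *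
      (ck c (N+1) j - (1 + (X ^ c) ^ (2*N+2) - μ * (X ^ c) ^ N) * ck c N j) =
    (-1)^k * (C k * (X ^ c) ^ (N+2+k) * ck c N (k+1) + C (k+1) * (X ^ c) ^ (N - k) * ck c N k) := by
  have hP : Pn c c (2 * (N+1) + 1) = Pn c c (2*N+1) * (1 - (X ^ c) ^ (2*N+2)) * (1 - (X ^ c) ^ (2*N+3)) := by
    rw [show 2 * (N+1) + 1 = 2*N+1+1+1 by ring, Pcc_succ, Pcc_succ]
  induction k with
  | zero =>
    simp only [zero_add, Finset.sum_range_one, ck, hP, h1]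
    have e1 : ipc c ((N : ℤ) - (0 : ℕ)) = (1 - (X ^ c) ^ (N+1)) * ipc c (((N + 1 : ℕ) : ℤ) - (0 : ℕ)) :=
      ipc_pred hc _ (by push_cast; ring) (by push_cast; ring)
    have e2 : ipc c ((N : ℤ) - (1 : ℕ)) = (1 - (X ^ c) ^ N) * ipc c ((N : ℤ) - (0 : ℕ)) :=
      ipc_pred hc _ (by push_cast; ring) (by push_cast; ring)
    have e3 : ipc c ((N : ℤ) + 1 + (0 : ℕ)) = (1 - (X ^ c) ^ (N+2)) * ipc c ((N : ℤ) + 1 + (1 : ℕ)) :=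
      ipc_pred hc _ (by push_cast; ring) (by push_cast; ring)
    have e4 : ((N + 1 : ℕ) : ℤ) + 1 + (0 : ℕ) = (N : ℤ) + 1 + (1 : ℕ) := by push_cast; ring
    rw [e2, e1, e4, e3, Nat.sub_zero]
    generalize (X : A) ^ c = Q
    ring
  | succ k ih =>
    rw [Finset.sum_range_succ, ih (by omega)]
    obtain ⟨a, rfl⟩ : ∃ a, N = a + (k + 1) := ⟨N - (k + 1), by omega⟩
    have s1 : a + (k+1) - k = a + 1 := by omega
    have s2 : a + (k+1) - (k+1) = a := by omega
    have e1 : ipc c (((a + (k + 1) : ℕ) : ℤ) - (k + 1 : ℕ)) = (1 - (X ^ c) ^ (a+1)) * ipc c (((a + (k + 1) + 1 : ℕ) : ℤ) - (k + 1 : ℕ)) :=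
      ipc_pred hc _ (by push_cast; ring) (by push_cast; ring)
    have e2 : ipc c (((a + (k + 1) : ℕ) : ℤ) - (k + 1 + 1 : ℕ)) = (1 - (X ^ c) ^ a) * ipc c (((a + (k + 1) : ℕ) : ℤ) - (k + 1 : ℕ)) :=
      ipc_pred hc _ (by push_cast; ring) (by push_cast; ring)
    have e3 : ipc c (((a + (k + 1) : ℕ) : ℤ) + 1 + (k + 1 : ℕ)) = (1 - (X ^ c) ^ (a + (k + 1) + 1 + (k + 1 + 1))) * ipc c (((a + (k + 1) : ℕ) : ℤ) + 1 + (k + 1 + 1 : ℕ)) :=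
      ipc_pred hc _ (by push_cast; ring) (by push_cast; ring)
    have e4 : ((a + (k + 1) + 1 : ℕ) : ℤ) + 1 + (k + 1 : ℕ) = ((a + (k + 1) : ℕ) : ℤ) + 1 + (k + 1 + 1 : ℕ) := by push_cast; ring
    have e5 : ((a + (k + 1) : ℕ) : ℤ) - k = ((a + (k + 1) + 1 : ℕ) : ℤ) - (k + 1 : ℕ) := by push_cast; ring
    have e6 : ipc c (((a + (k + 1) : ℕ) : ℤ) + 1 + k) = (1 - (X ^ c) ^ (a + (k + 1) + 1 + (k + 1))) * ipc c (((a + (k + 1) : ℕ) : ℤ) + 1 + (k + 1 : ℕ)) :=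
      ipc_pred hc _ (by push_cast; ring) (by push_cast; ring)
    simp only [ck, hP, s1, s2, h2 k]
    rw [e2, e1, e4, e5, e6, e3]
    generalize (X : A) ^ c = Q
    ring

theorem jtp_fin {c : ℕ} (hc : 0 < c) (C : ℕ → A) (μ : A) (h1 : C 1 = (μ + X ^ c) * C 0)
  (h2 : ∀ k, C (k+2) = μ * (X ^ c) ^ (k+1) * C (k+1) - (X ^ c) ^ (2*k+3) * C k)
    (N : ℕ) : ∑ j ∈ Finset.range (N+1), (-1)^j * C j * ck c N j =
    C 0 * ∏ j ∈ Finset.range N, (1 + (X ^ c) ^ (2*j+2) - μ * (X ^ c) ^ j) := by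
  induction N with
  | zero => simp [ck_diag hc]
  | succ N ih =>
    rw [Finset.prod_range_succ, ← mul_assoc, ← ih, Finset.sum_range_succ]
    have h := jtp_tele hc C μ h1 h2 N N le_rfl
    rw [ck_over c N (N+1) (by omega), ck_diag hc] at h
    rw [ck_diag hc]
    simp only [mul_sub, Finset.sum_sub_distrib] at h
    simp only [Nat.sub_self, pow_zero] at h
    have e : ∀ S : A, ∑ x ∈ Finset.range (N + 1), (-1) ^ x * C x * ((1 + (X ^ c) ^ (2 * N + 2) - S) * ck c N x)
      = (1 + (X ^ c) ^ (2 * N + 2) - S) * ∑ x ∈ Finset.range (N + 1), (-1) ^ x * C x * ck c N x := by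
      intro S
      rw [Finset.mul_sum]
      apply Finset.sum_congr rfl
      intros; ring
    rw [e] at h
    linear_combination h

theorem jtp_lim {c : ℕ} (hc : 0 < c) (C : ℕ → A) (μ : A) (h1 : C 1 = (μ + X ^ c) * C 0)
  (h2 : ∀ k, C (k+2) = μ * (X ^ c) ^ (k+1) * C (k+1) - (X ^ c) ^ (2*k+3) * C k)
    (hd : ∀ k, (X : A) ^ k ∣ C k) (L : A)
    (hL : Tendsto (fun N => C 0 * ∏ j ∈ Finset.range N, (1 + (X ^ c) ^ (2*j+2) - μ * (X ^ c) ^ j))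
      atTop (𝓝 L)) :
    HasSum (fun k => (-1)^k * C k) (L * Pi' c c) := by
  have hb : Tendsto (fun k : ℕ => k) cofinite atTop := by
    rw [Nat.cofinite_eq_atTop]; exact tendsto_id
  have hw : ∀ k, (X : A) ^ k ∣ (-1)^k * C k := fun k => (hd k).mul_left _
  have hlim := tendsto_P c c hc
  have hi : Tendsto (fun N => (Pn c c N)⁻¹) atTop (𝓝 (Pi' c c)⁻¹) :=
    tendsto_inv' hlim (fun i => cc_Pn c c i hc) (cc_P c c hc hc)
  have hcan := inv_cancel (cc_P c c hc hc)
  have hG : ∀ k, Tendsto (fun N => ck c N k) atTop (𝓝 (Pi' c c)⁻¹) := by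
    intro k
    have t1 : Tendsto (fun N => Pn c c (2*N+1)) atTop (𝓝 (Pi' c c)) :=
      hlim.comp (tendsto_atTop_mono (fun N => by simp only [id]; omega) tendsto_id)
    have t2 : Tendsto (fun N : ℕ => ipc c ((N : ℤ) - k)) atTop (𝓝 (Pi' c c)⁻¹) := by
      have : Tendsto (fun N => (Pn c c (N - k))⁻¹) atTop (𝓝 (Pi' c c)⁻¹) :=
        hi.comp (tendsto_sub_atTop_nat k)
      refine this.congr' ?_
      filter_upwards [eventually_ge_atTop k] with N hN
      rw [← ipc_nat]; congr 1; push_cast [hN]; ring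
    have t3 : Tendsto (fun N : ℕ => ipc c ((N : ℤ) + 1 + k)) atTop (𝓝 (Pi' c c)⁻¹) := by
      have : Tendsto (fun N => (Pn c c (N + (1 + k)))⁻¹) atTop (𝓝 (Pi' c c)⁻¹) :=
        hi.comp (tendsto_add_atTop_nat (1 + k))
      refine this.congr ?_
      intro N
      rw [← ipc_nat]; congr 1; push_cast; ring
    have := (t1.mul t2).mul t3
    rw [hcan, one_mul] at this
    exact this
  have := tannery (fun N => Finset.range (N+1))
    (fun i => by filter_upwards [eventually_ge_atTop i] with N hN; simp; omega)
    (fun k => (-1)^k * C k) (fun k => k) hb hw (ck c) _ hG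
  simp only [jtp_fin hc C μ h1 h2] at this
  have h := tendsto_nhds_unique this hL
  have hs := (summable_of_dvd hb hw).hasSum
  convert hs using 1
  rw [← h]
  linear_combination (∑' k, (-1)^k * C k) * hcan

/-- Jacobi's cube coefficients. -/
noncomputable def Cj (k : ℕ) : A := (2 * (k : A) + 1) * X ^ (k.choose 2 + k)

theorem choose_two_succ (k : ℕ) : (k+1).choose 2 = k.choose 2 + k := by
  simp [Nat.choose_succ_succ']; ring

theorem jacobi : HasSum (fun k => (-1)^k * Cj k) (E ^ 3) := by
  have hL : Tendsto (fun N => Cj 0 * ∏ j ∈ Finset.range N, (1 + (X ^ 1) ^ (2*j+2) - (2 * X) * (X ^ 1) ^ j))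
      atTop (𝓝 (E ^ 2)) := by
    have := (tendsto_P 1 1 one_pos).pow 2
    refine this.congr ?_
    intro N
    rw [Pn, ← Finset.prod_pow]
    simp only [Cj, Nat.choose_zero_succ, Nat.cast_zero, mul_zero, zero_add, pow_zero, mul_one, one_mul]
    apply Finset.prod_congr rfl
    intros; ring
  have := jtp_lim one_pos Cj (2 * X) ?_ ?_ ?_ _ hL
  · simpa only [E, pow_succ, pow_zero, one_mul] using this
  · simp [Cj]; ring
  · intro k
    simp only [Cj, choose_two_succ]
    push_cast
    ring
  · intro k
    apply Dvd.dvd.mul_left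
    exact pow_dvd_pow _ (by omega)

/-- Coefficients of `J0`. -/
noncomputable def C0 (k : ℕ) : A := X ^ (25 * k.choose 2 + 15 * k) - X ^ (25 * k.choose 2 + 35 * k + 10)

/-- Coefficients of `J1`. -/
noncomputable def C1 (k : ℕ) : A := X ^ (25 * k.choose 2 + 20 * k) - X ^ (25 * k.choose 2 + 30 * k + 5)

/-- First theta function. -/
noncomputable def J0 : A := Pi' 10 25 * Pi' 15 25 * Pi' 25 25

/-- Second theta function. -/
noncomputable def J1 : A := Pi' 5 25 * Pi' 20 25 * Pi' 25 25

theorem prod_aux (a b : ℕ) (C : A) (μ : A) (hC : C = 1 - X ^ a) (hab : a + b = 25)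
    (hμ : μ = X ^ (25 + a) + X ^ b) :
    Tendsto (fun N => C * ∏ j ∈ Finset.range N, (1 + (X ^ 25) ^ (2*j+2) - μ * (X ^ 25) ^ j))
      atTop (𝓝 (Pi' a 25 * Pi' b 25)) := by
  have := ((tendsto_P a 25 (by norm_num)).comp (tendsto_add_atTop_nat 1)).mul (tendsto_P b 25 (by norm_num))
  refine this.congr ?_
  intro N
  simp only [Function.comp]
  subst hC hμ
  induction N with
  | zero => simp [Pn]
  | succ N ih =>
    rw [Finset.prod_range_succ, ← mul_assoc, ← ih, Pn_succ a, Pn_succ b]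
    have : (X : A) ^ 25 = X ^ a * X ^ b := by rw [← pow_add, hab]
    rw [pow_add _ a, pow_add _ b, pow_add _ 25 a, pow_mul _ 25, pow_mul _ 25, this]
    ring

theorem hasSum_J0 : HasSum (fun k => (-1)^k * C0 k) J0 := by
  refine jtp_lim (c := 25) (by norm_num) C0 (X ^ 35 + X ^ 15) ?_ ?_ ?_ _
    (prod_aux 10 15 _ _ (by simp [C0]) rfl (by ring))
  · simp [C0]; ring
  · intro k
    simp only [C0, choose_two_succ]
    ring
  · intro k
    exact dvd_sub (pow_dvd_pow _ (by omega)) (pow_dvd_pow _ (by omega))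

theorem hasSum_J1 : HasSum (fun k => (-1)^k * C1 k) J1 := by
  refine jtp_lim (c := 25) (by norm_num) C1 (X ^ 30 + X ^ 20) ?_ ?_ ?_ _
    (prod_aux 5 20 _ _ (by simp [C1]) rfl (by ring))
  · simp [C1]; ring
  · intro k
    simp only [C1, choose_two_succ]
    ring
  · intro k
    exact dvd_sub (pow_dvd_pow _ (by omega)) (pow_dvd_pow _ (by omega))

theorem two_choose (k : ℕ) : 2 * (k.choose 2 : ℤ) = k * (k - 1) := by
  induction k with
  | zero => simp
  | succ k ih => rw [choose_two_succ]; push_cast; linarith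

theorem block (m : ℕ) : ∑ s ∈ Finset.range 5, (-1)^(5*m+s) * Cj (5*m+s) =
    (-1)^m * C0 m - 3 * X * ((-1)^m * C1 m) := by
  have t0 : (5*m+0).choose 2 + (5*m+0) = 25 * m.choose 2 + 15 * m := by
    have a := two_choose (5*m+0); have b := two_choose m; push_cast at a b; zify; linarith
  have t1 : (5*m+1).choose 2 + (5*m+1) = 25 * m.choose 2 + 20 * m + 1 := by
    have a := two_choose (5*m+1); have b := two_choose m; push_cast at a b; zify; linarith
  have t3 : (5*m+3).choose 2 + (5*m+3) = 25 * m.choose 2 + 30 * m + 5 + 1 := by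
    have a := two_choose (5*m+3); have b := two_choose m; push_cast at a b; zify; linarith
  have t4 : (5*m+4).choose 2 + (5*m+4) = 25 * m.choose 2 + 35 * m + 10 := by
    have a := two_choose (5*m+4); have b := two_choose m; push_cast at a b; zify; linarith
  have hs : (-1 : A) ^ (5*m) = (-1) ^ m := by rw [pow_mul]; norm_num
  have h5 := five_eq_zero
  simp only [Finset.sum_range_succ, Finset.sum_range_zero, Cj, t0, t1, t3, t4, C0, C1]
  simp only [pow_add (-1 : A), hs]
  push_cast
  have e2 : (2 * (5 * (m : A) + 2) + 1) = 0 := by linear_combination (2 * (m:A) + 1) * h5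
  have e0 : (2 * (5 * (m : A) + 0) + 1) = 1 := by linear_combination (2 * (m:A)) * h5
  have e1 : (2 * (5 * (m : A) + 1) + 1) = 3 := by linear_combination (2 * (m:A)) * h5
  have e3 : (2 * (5 * (m : A) + 3) + 1) = -3 := by linear_combination (2 * (m:A) + 2) * h5
  have e4 : (2 * (5 * (m : A) + 4) + 1) = -1 := by linear_combination (2 * (m:A) + 2) * h5
  rw [e0, e1, e2, e3, e4]
  ring

theorem E_cube : E ^ 3 = J0 - 3 * X * J1 := by
  have h1 := (hasSum_J0.sub (hasSum_J1.mul_left (3 * X))).tendsto_sum_nat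
  have h2 : Tendsto (fun N => ∑ k ∈ Finset.range (5 * N), (-1)^k * Cj k) atTop (𝓝 (E ^ 3)) :=
    jacobi.tendsto_sum_nat.comp (tendsto_atTop_mono (fun N => by simp only [id]; omega) tendsto_id)
  refine tendsto_nhds_unique (h2.congr ?_) h1
  intro N
  induction N with
  | zero => simp
  | succ N ih =>
    rw [Finset.sum_range_succ, ← ih, ← block, mul_add, Finset.sum_range_add]

theorem Sp_sub {r : ZMod 5} {f g : A} (hf : Sp r f) (hg : Sp r g) : Sp r (f - g) := by
  intro n hn; rw [map_sub, hf n hn, hg n hn, sub_zero]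

theorem Sp_neg_pow {r : ZMod 5} {f : A} (k : ℕ) (hf : Sp r f) : Sp r ((-1)^k * f) := by
  rcases neg_one_pow_eq_or A k with h | h
  · rw [h, one_mul]; exact hf
  · rw [h]; intro n hn; simp [hf n hn]

theorem Sp_X5 (k : ℕ) (h : 5 ∣ k) : Sp 0 (X ^ k : A) := by
  have := Sp_X k
  rwa [(ZMod.natCast_eq_zero_iff k 5).2 h] at this

theorem Sp_J0 : Sp 0 J0 :=
  Sp_tsum hasSum_J0 (fun k => Sp_neg_pow k (Sp_sub (Sp_X5 _ (by omega)) (Sp_X5 _ (by omega))))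

theorem Sp_J1 : Sp 0 J1 :=
  Sp_tsum hasSum_J1 (fun k => Sp_neg_pow k (Sp_sub (Sp_X5 _ (by omega)) (Sp_X5 _ (by omega))))

end Spt5

namespace Spt5

/-- Sum of the arithmetic progression `5 m + s`. -/
def Gf (s M : ℤ) : ℤ := 5 * (M * (M - 1) / 2) + s * M

/-- Number of class elements below `i`. -/
def Mf (i s : ℤ) : ℤ := (i - s + 4) / 5

theorem tri2 (M : ℤ) : 2 * (M * (M - 1) / 2) = M * (M - 1) := by
  apply Int.mul_ediv_cancel'
  have := Int.even_mul_succ_self (M - 1)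
  rw [sub_add_cancel, mul_comm] at this
  exact this.two_dvd

theorem Gf_succ (s M : ℤ) : Gf s (M + 1) = Gf s M + (5 * M + s) := by
  have h1 := tri2 M
  have h2 := tri2 (M + 1)
  rw [Gf, Gf]
  have : (M + 1) * (M + 1 - 1) / 2 = M * (M - 1) / 2 + M := by linarith
  rw [this]; ring

section field
variable {K : Type*} [Field K]

/-- Differences normalised to positive exponents. -/
def DK (y : K) (k : ℤ) : K := if k = 0 then 1 else 1 - y ^ k.natAbs

theorem prod_geo (y : K) (hy : y ≠ 0) (s a b : ℤ) (h : a ≤ b) :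
    ∏ m ∈ Finset.Ico a b, (-(y ^ (5 * m + s))) = (-1) ^ (b - a) * y ^ (Gf s b - Gf s a) := by
  induction b, h using Int.leInduction with
  | base => simp
  | succ b hb ih =>
    rw [← Finset.insert_Ico_right_eq_Ico_add_one hb, Finset.prod_insert (by simp), ih, Gf_succ,
      show b + 1 - a = (b - a) + 1 by ring, zpow_add₀ (by norm_num : (-1 : K) ≠ 0),
      show Gf s b + (5 * b + s) - Gf s a = (5 * b + s) + (Gf s b - Gf s a) by ring, zpow_add₀ hy (5 * b + s) (Gf s b - Gf s a), zpow_one]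
    ring

theorem prod_cls (y : K) (hy : y ≠ 0) (N i s : ℤ) (h1 : -N ≤ Mf i s) (h2 : Mf i s ≤ N) :
    ∏ m ∈ Finset.Ico (-N) N, (if 5 * m + s < i then -(y ^ (5 * m + s)) else y ^ i) =
    (-1) ^ (Mf i s + N) * y ^ ((N - Mf i s) * i + Gf s (Mf i s) - Gf s (-N)) := by
  rw [← Finset.Ico_union_Ico_eq_Ico h1 h2, Finset.prod_union (Finset.Ico_disjoint_Ico_consecutive _ _ _)]
  have e1 : ∏ m ∈ Finset.Ico (-N) (Mf i s), (if 5 * m + s < i then -(y ^ (5 * m + s)) else y ^ i) =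
      ∏ m ∈ Finset.Ico (-N) (Mf i s), (-(y ^ (5 * m + s))) := by
    apply Finset.prod_congr rfl
    intro m hm
    rw [Finset.mem_Ico] at hm
    rw [if_pos]
    simp only [Mf] at hm
    omega
  have e2 : ∏ m ∈ Finset.Ico (Mf i s) N, (if 5 * m + s < i then -(y ^ (5 * m + s)) else y ^ i) =
      ∏ m ∈ Finset.Ico (Mf i s) N, (y ^ i) := by
    apply Finset.prod_congr rfl
    intro m hm
    rw [Finset.mem_Ico] at hm
    rw [if_neg]
    simp only [Mf] at hm
    omega
  rw [e1, e2, prod_geo y hy _ _ _ h1, Finset.prod_const, Int.card_Ico, ← zpow_natCast, ← zpow_mul,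
    Int.toNat_of_nonneg (by omega), mul_assoc, ← zpow_add₀ hy]
  congr 2 <;> ring

/-- Differences with a diagonal convention. -/
def Dl (y : K) (i j : ℤ) : K := if i = j then y ^ i else y ^ i - y ^ j

theorem Dl_eq (y : K) (hy : y ≠ 0) (i j : ℤ) :
    Dl y i j = (if j < i then -(y ^ j) else y ^ i) * DK y (i - j) := by
  rw [Dl, DK]
  rcases lt_trichotomy i j with h | h | h
  · rw [if_neg (by omega), if_neg (by omega), if_neg (by omega), mul_sub, ← zpow_natCast, ← zpow_add₀ hy]
    rw [mul_one]; congr 2; omega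
  · subst h; simp
  · rw [if_neg (by omega), if_pos h, if_neg (by omega), mul_sub, ← zpow_natCast, neg_mul, neg_mul, ← zpow_add₀ hy]
    rw [mul_one, show j + ((i - j).natAbs : ℤ) = i by omega]; ring

theorem prod_Dl (y : K) (hy : y ≠ 0) (N i s : ℤ) (h1 : -N ≤ Mf i s) (h2 : Mf i s ≤ N) :
    ∏ m ∈ Finset.Ico (-N) N, Dl y i (5 * m + s) =
    (-1) ^ N * y ^ (N * i - Gf s (-N)) * ((-1) ^ (Mf i s) * y ^ (Mf i s * i - Gf s (Mf i s)))⁻¹ *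
      ∏ m ∈ Finset.Ico (-N) N, DK y (i - (5 * m + s)) := by
  simp only [Dl_eq y hy, Finset.prod_mul_distrib]
  rw [prod_cls y hy N i s h1 h2, mul_inv, ← zpow_neg y, ← inv_zpow (-1 : K), inv_neg_one,
    mul_mul_mul_comm, ← zpow_add₀ hy, ← zpow_add₀ (by norm_num : (-1 : K) ≠ 0)]
  congr 3 <;> ring

theorem lag (y : K) (hy : y ≠ 0) (hy1 : ∀ i : ℤ, i ≠ 0 → y ^ i ≠ 1) (N : ℕ) (hN : 1 ≤ N) (T : Finset ℤ)
    (hT : ∀ s ∈ T, 0 < s ∧ s < 5) (hcard : T.card = 3) (c : ℕ) (hc : c ≤ 1) :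
    (∏ s' ∈ T, ∏ m' ∈ Finset.Ico (-(N : ℤ)) N, DK y (0 - (5 * m' + s')))⁻¹ +
    ∑ s ∈ T, ∑ m ∈ Finset.Ico (-(N : ℤ)) N, (y ^ (c * (5 * m + s)) *
      (∏ s' ∈ T, ((-1) ^ (Mf (5 * m + s) s') * y ^ (Mf (5 * m + s) s' * (5 * m + s) - Gf s' (Mf (5 * m + s) s'))))
       / (y ^ (5 * m + s) - 1)) * (∏ s' ∈ T, ∏ m' ∈ Finset.Ico (-(N : ℤ)) N, DK y ((5 * m + s) - (5 * m' + s')))⁻¹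
      = 0 := by
  classical
  set I := Finset.Ico (-(N : ℤ)) N with hI
  set S := (T ×ˢ I).image (fun p => 5 * p.2 + p.1) with hS
  have hinj : Set.InjOn (fun p : ℤ × ℤ => 5 * p.2 + p.1) (T ×ˢ I : Finset (ℤ × ℤ)) := by
    rintro ⟨a, b⟩ hab ⟨a', b'⟩ hab' h
    simp only [Finset.coe_product, Set.mem_prod, Finset.mem_coe] at hab hab'
    have := hT a hab.1; have := hT a' hab'.1
    simp only at h
    ext <;> simp <;> omega
  have h0 : (0 : ℤ) ∉ S := by
    rw [hS, Finset.mem_image]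
    rintro ⟨⟨a, b⟩, hab, h⟩
    rw [Finset.mem_product] at hab
    have := hT a hab.1
    simp only at h
    omega
  have hSc : S.card = 6 * N := by
    rw [hS, Finset.card_image_of_injOn hinj, Finset.card_product, hcard, hI, Int.card_Ico]
    omega
  have hinj2 : Set.InjOn (fun i : ℤ => y ^ i) (insert 0 S : Finset ℤ) := by
    intro i _ j _ h
    by_contra hne
    apply hy1 (i - j) (by omega)
    rw [zpow_sub₀ hy]
    simp only at h
    rw [h, div_self (zpow_ne_zero _ hy)]
  have hcardI : (insert 0 S).card = 6 * N + 1 := by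
    rw [Finset.card_insert_of_notMem h0, hSc]
  have hL := Lagrange.coeff_eq_sum (v := fun i : ℤ => y ^ i) hinj2
    (P := (Polynomial.X : Polynomial K) ^ (3 * N + c - 1)) (by
      rw [Polynomial.degree_X_pow, hcardI]
      norm_cast
      omega)
  rw [hcardI, Polynomial.coeff_X_pow, if_neg (by omega)] at hL
  simp only [Polynomial.eval_pow, Polynomial.eval_X] at hL
  have hterm : ∀ i ∈ insert 0 S, (y ^ i) ^ (3 * N + c - 1) / ∏ j ∈ (insert 0 S).erase i, (y ^ i - y ^ j) =
      y ^ ((3 * N + c) * i) / (Dl y i 0 * ∏ j ∈ S, Dl y i j) := by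
    intro i hi
    rw [← Finset.prod_insert h0, ← Finset.mul_prod_erase _ _ hi]
    have e : ∏ j ∈ (insert 0 S).erase i, Dl y i j = ∏ j ∈ (insert 0 S).erase i, (y ^ i - y ^ j) := by
      apply Finset.prod_congr rfl
      intro j hj
      rw [Dl, if_neg (Finset.ne_of_mem_erase hj).symm]
    rw [e, show Dl y i i = y ^ i by simp [Dl]]
    have hyi : y ^ i ≠ 0 := zpow_ne_zero _ hy
    rw [← mul_div_mul_left _ _ hyi, ← pow_succ', ← zpow_natCast, ← zpow_mul]
    congr 2
    rw [mul_comm]; congr 1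
    push_cast [show 1 ≤ 3 * N + c by omega]; ring
  rw [Finset.sum_congr rfl hterm, Finset.sum_insert h0, hS, Finset.sum_image hinj, Finset.sum_product] at hL
  simp only [Finset.prod_image hinj, Finset.prod_product] at hL
  set Z : K := ∏ s' ∈ T, (-1) ^ (N : ℤ) * y ^ (-Gf s' (-N)) with hZ
  have hZ0 : Z ≠ 0 := by
    rw [hZ]; apply Finset.prod_ne_zero_iff.2; intro s' _
    exact mul_ne_zero (zpow_ne_zero _ (by norm_num)) (zpow_ne_zero _ hy)
  have key : ∀ i : ℤ, -(5 * N : ℤ) ≤ i → i < 5 * N → y ^ ((3 * N + c) * i) / (Dl y i 0 * ∏ s' ∈ T, ∏ m ∈ I, Dl y i (5 * m + s')) =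
      Z⁻¹ * ((y ^ (c * i) * (∏ s' ∈ T, ((-1) ^ (Mf i s') * y ^ (Mf i s' * i - Gf s' (Mf i s')))) / Dl y i 0) *
        (∏ s' ∈ T, ∏ m' ∈ I, DK y (i - (5 * m' + s')))⁻¹) := by
    intro i hi1 hi2
    have e1 : ∏ s' ∈ T, ∏ m ∈ I, Dl y i (5 * m + s') = ∏ s' ∈ T, (((-1) ^ (N : ℤ) * y ^ (-Gf s' (-N))) * y ^ (N * i) *
        ((-1) ^ (Mf i s') * y ^ (Mf i s' * i - Gf s' (Mf i s')))⁻¹ * ∏ m ∈ I, DK y (i - (5 * m + s'))) := by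
      apply Finset.prod_congr rfl
      intro s' hs'
      have := hT s' hs'
      rw [hI, prod_Dl y hy N i s' (by rw [Mf]; omega) (by rw [Mf]; omega), sub_eq_neg_add, zpow_add₀ hy]
      ring
    rw [e1]
    simp only [Finset.prod_mul_distrib (s := T), Finset.prod_inv_distrib, Finset.prod_const, hcard]
    have e2 : y ^ ((3 * N + c) * i) = (y ^ (N * i)) ^ 3 * y ^ (c * i) := by
      rw [← zpow_natCast, ← zpow_mul, ← zpow_add₀ hy]; congr 1; push_cast; ring
    rw [e2]
    have : (y ^ (N * i)) ^ 3 ≠ 0 := pow_ne_zero _ (zpow_ne_zero _ hy)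
    rw [hZ]
    simp only [Finset.prod_mul_distrib (s := T), Finset.prod_const, hcard]
    simp only [div_eq_mul_inv, mul_inv, inv_inv]
    field_simp
  rw [key 0 (by omega) (by omega), Finset.sum_congr rfl (fun s hs => Finset.sum_congr rfl (fun m hm =>
    key (5 * m + s) (by have := hT s hs; rw [hI, Finset.mem_Ico] at hm; omega)
      (by have := hT s hs; rw [hI, Finset.mem_Ico] at hm; omega)))] at hL
  simp only [← Finset.mul_sum] at hL
  rw [← mul_add, eq_comm, mul_eq_zero, or_iff_right (inv_ne_zero hZ0)] at hL
  rw [← hL]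
  congr 1
  · have : ∀ s' ∈ T, ((-1 : K) ^ (Mf 0 s') * y ^ (Mf 0 s' * 0 - Gf s' (Mf 0 s'))) = 1 := by
      intro s' hs'
      have := hT s' hs'
      have : Mf 0 s' = 0 := by rw [Mf]; omega
      rw [this, Gf]; simp
    rw [Finset.prod_congr rfl this]
    simp [Dl]
  · apply Finset.sum_congr rfl
    intro s hs
    apply Finset.sum_congr rfl
    intro m hm
    have : Dl y (5 * m + s) 0 = y ^ (5 * m + s) - 1 := by
      have := hT s hs
      rw [Dl, if_neg (by omega), zpow_zero]
    rw [this]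

end field

end Spt5

namespace Spt5

/-- Normalised differences in `A`. -/
noncomputable def DA (k : ℤ) : A := if k = 0 then 1 else 1 - X ^ (5 * k.natAbs)

/-- Exponent numerators. -/
def hx (i : ℤ) : ℤ := i * (3 * i + 1) / 2

theorem hx2 (i : ℤ) : 2 * hx i = i * (3 * i + 1) := by
  apply Int.mul_ediv_cancel'
  rcases Int.even_or_odd i with h | h
  · exact (h.mul_right _).two_dvd
  · have : Even (3 * i + 1) := by
      obtain ⟨k, rfl⟩ := h; exact ⟨3 * k + 2, by ring⟩
    exact (this.mul_left _).two_dvd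

/-- Exponent base. -/
def ex (r : ℕ) : ℕ := 2 * r + 3 * r.choose 2

/-- Bilateral summands. -/
noncomputable def tau (b : ℕ) (i : ℤ) : A :=
  if 0 < i then (-1) ^ i.natAbs * X ^ (ex i.natAbs + b * i.natAbs) * (1 - X ^ (5 * i.natAbs))⁻¹
  else -((-1) ^ i.natAbs * X ^ (ex i.natAbs + (4 - b) * i.natAbs) * (1 - X ^ (5 * i.natAbs))⁻¹)

/-- The field of fractions. -/
abbrev KA := FractionRing A

/-- The embedding. -/
noncomputable abbrev ph : A →+* KA := algebraMap A KA

theorem ph_inj : Function.Injective ph := IsFractionRing.injective A KA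

theorem ph_inv {f : A} (h : constantCoeff f = 1) : ph f⁻¹ = (ph f)⁻¹ := by
  apply eq_inv_of_mul_eq_one_right
  rw [← map_mul, inv_cancel h, map_one]

theorem phX_ne : ph X ≠ 0 := by
  rw [Ne, map_eq_zero_iff _ ph_inj]; exact X_ne_zero

theorem one_sub_ne (n : ℕ) (h : 0 < n) : (1 - ph X ^ n) ≠ 0 := by
  rw [← map_pow, ← map_one ph, ← map_sub, Ne, map_eq_zero_iff _ ph_inj]
  exact cc_ne (cc_one_sub n h)

theorem phX_zpow (i : ℤ) (h : i ≠ 0) : (ph X ^ 5) ^ i ≠ 1 := by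
  intro h1
  have h2 : (ph X ^ 5) ^ i.natAbs = 1 := by
    rcases Int.natAbs_eq i with h3 | h3
    · rw [h3, zpow_natCast] at h1; exact h1
    · rw [h3, zpow_neg, inv_eq_one, zpow_natCast] at h1; exact h1
  rw [← pow_mul] at h2
  exact one_sub_ne (5 * i.natAbs) (by omega) (by rw [h2, sub_self])

theorem ph_DA (k : ℤ) : ph (DA k) = DK (ph X ^ 5) k := by
  rw [DA, DK]
  split_ifs with h
  · simp
  · rw [map_sub, map_one, map_pow, pow_mul]

theorem cc_DA (k : ℤ) : constantCoeff (DA k) = 1 := by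
  rw [DA]
  split_ifs with h
  · simp
  · exact cc_one_sub _ (by omega)

theorem ex_hx (r : ℕ) : hx r = ex r := by
  have h1 := hx2 r
  have h2 := two_choose r
  rw [ex]; push_cast; linarith

theorem ex_hx_neg (r : ℕ) : hx (-r) = ex r - r := by
  have h1 := hx2 (-r)
  have h2 := two_choose r
  rw [ex]; push_cast; linarith

theorem ph_tau (b : ℕ) (hb : b ≤ 4) (i : ℤ) (hi : i ≠ 0) :
    ph (tau b i) = (-1) ^ i * ph X ^ (hx i + b * i) / (1 - (ph X ^ 5) ^ i) := by
  have hX := phX_ne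
  rw [tau]
  split_ifs with h
  · obtain ⟨r, rfl⟩ : ∃ r : ℕ, i = r := ⟨i.natAbs, by omega⟩
    rw [map_mul, map_mul, ph_inv (cc_one_sub _ (by omega))]
    simp only [map_sub, map_pow, map_neg, map_one, Int.natAbs_natCast]
    rw [ex_hx, zpow_natCast, zpow_natCast, ← pow_mul, div_eq_mul_inv]
    norm_cast
  · obtain ⟨r, rfl⟩ : ∃ r : ℕ, i = -(r : ℤ) := ⟨i.natAbs, by omega⟩
    have hr : 0 < r := by omega
    rw [map_neg, map_mul, map_mul, ph_inv (cc_one_sub _ (by omega))]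
    simp only [map_sub, map_pow, map_neg, map_one, Int.natAbs_natCast, Int.natAbs_neg]
    rw [ex_hx_neg, zpow_neg, zpow_neg, zpow_natCast, zpow_natCast, ← pow_mul]
    have e : ((-1 : KA) ^ r)⁻¹ = (-1) ^ r := by rw [← inv_pow]; norm_num
    have e2 : ph X ^ ((ex r : ℤ) - r + b * -(r : ℤ)) = ph X ^ (ex r + (4 - b) * r) * (ph X ^ (5 * r))⁻¹ := by
      rw [← zpow_natCast, ← zpow_natCast, ← zpow_neg, ← zpow_add₀ hX]
      congr 1
      push_cast [hb]; ring
    have h1 := one_sub_ne (5 * r) (by omega)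
    have h2 : ph X ^ (5 * r) ≠ 0 := pow_ne_zero _ hX
    rw [e, e2]
    generalize ph X ^ (5 * r) = z at *
    have h3 : 1 - z⁻¹ ≠ 0 := by
      intro h4
      apply h1
      have : z * (1 - z⁻¹) = z - 1 := by field_simp
      rw [h4, mul_zero] at this
      linear_combination this
    have h5 : z - 1 ≠ 0 := by intro h; apply h1; linear_combination -h
    have h6 : 1 - z⁻¹ = (z - 1) / z := by field_simp
    rw [h6]
    field_simp
    ring

theorem term_aux (b : ℕ) (hb : b ≤ 4) (i : ℤ) (hi : i ≠ 0) (e M : ℤ) (ku κ : ℕ)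
    (h1 : 5 * e + 4 = hx i + b * i + ku) (h2 : Even (M + 1 + κ - i)) :
    ph X ^ 4 * ((-1) ^ M * (ph X ^ 5) ^ e / ((ph X ^ 5) ^ i - 1)) = ph ((-1) ^ κ * X ^ ku * tau b i) := by
  have hX := phX_ne
  rw [map_mul, ph_tau b hb i hi]
  simp only [map_mul, map_pow, map_neg, map_one]
  have h3 : ph X ^ 4 * (ph X ^ 5) ^ e = ph X ^ ku * ph X ^ (hx i + b * i) := by
    rw [← zpow_natCast _ 4, ← zpow_natCast _ 5, ← zpow_natCast _ ku, ← zpow_mul, ← zpow_add₀ hX, ← zpow_add₀ hX]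
    congr 1; push_cast; linarith
  have hm : (-1 : KA) ≠ 0 := by norm_num
  have h4 : (-1 : KA) ^ M * (-1) * ((-1) ^ κ * (-1) ^ i) = 1 := by
    have := h2.neg_one_zpow (α := KA)
    rw [zpow_sub₀ hm, zpow_add₀ hm, zpow_add₀ hm, zpow_one, zpow_natCast] at this
    have h5 : ((-1 : KA) ^ i)⁻¹ = (-1) ^ i := by rw [← inv_zpow]; norm_num
    rw [div_eq_mul_inv, h5] at this
    linear_combination this
  have h5 : ((-1 : KA) ^ M) = -((-1) ^ κ * (-1) ^ i) := by
    have h6 : ((-1 : KA) ^ κ * (-1) ^ i) * ((-1) ^ κ * (-1) ^ i) = 1 := by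
      rw [mul_mul_mul_comm, ← mul_zpow, ← mul_pow]; norm_num
    linear_combination (-((-1 : KA) ^ κ * (-1) ^ i)) * h4 - (-1 : KA) ^ M * h6
  have h6 := phX_zpow i hi
  have h7 : (ph X ^ 5) ^ i - 1 ≠ 0 := sub_ne_zero.2 h6
  have h8 : 1 - (ph X ^ 5) ^ i ≠ 0 := sub_ne_zero.2 (Ne.symm h6)
  rw [h5]
  generalize (ph X ^ 5) ^ i = z at *
  rw [mul_div_assoc', mul_div_assoc', div_eq_div_iff h7 h8]
  linear_combination (-((-1) ^ κ * (-1) ^ i)) * (1 - z) * h3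

theorem lagA (N : ℕ) (hN : 1 ≤ N) (T : Finset ℤ)
    (hT : ∀ s ∈ T, 0 < s ∧ s < 5) (hcard : T.card = 3) (c : ℕ) (hc : c ≤ 1) (b : ℕ) (u : ℤ → A)
    (hu : ∀ s ∈ T, ∀ m : ℤ, ph X ^ 4 * ((ph X ^ 5) ^ (c * (5 * m + s)) *
      (∏ s' ∈ T, ((-1) ^ (Mf (5 * m + s) s') * (ph X ^ 5) ^ (Mf (5 * m + s) s' * (5 * m + s) - Gf s' (Mf (5 * m + s) s'))))
       / ((ph X ^ 5) ^ (5 * m + s) - 1)) = ph (u s * tau b (5 * m + s))) :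
    X ^ 4 * (∏ s' ∈ T, ∏ m' ∈ Finset.Ico (-(N : ℤ)) N, DA (0 - (5 * m' + s')))⁻¹ +
    ∑ s ∈ T, ∑ m ∈ Finset.Ico (-(N : ℤ)) N, (u s * tau b (5 * m + s)) *
      (∏ s' ∈ T, ∏ m' ∈ Finset.Ico (-(N : ℤ)) N, DA ((5 * m + s) - (5 * m' + s')))⁻¹ = 0 := by
  have hcc : ∀ i : ℤ, constantCoeff (∏ s' ∈ T, ∏ m' ∈ Finset.Ico (-(N : ℤ)) N, DA (i - (5 * m' + s'))) = 1 := by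
    intro i; simp only [map_prod, cc_DA, Finset.prod_const_one]
  apply ph_inj
  have h := congrArg (fun z => ph X ^ 4 * z)
    (lag (ph X ^ 5) (pow_ne_zero _ phX_ne) phX_zpow N hN T hT hcard c hc)
  beta_reduce at h
  rw [mul_zero, mul_add] at h
  simp only [Finset.mul_sum] at h
  rw [map_zero, ← h, map_add, map_mul, map_sum, ph_inv (hcc _), map_pow]
  simp only [map_prod, ph_DA]
  congr 1
  apply Finset.sum_congr rfl
  intro s hs
  rw [map_sum]
  apply Finset.sum_congr rfl
  intro m hm
  rw [map_mul, ph_inv (hcc _), ← hu s hs m, ← mul_assoc (ph X ^ 4)]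
  simp only [map_prod, ph_DA]

theorem DA_neg (k : ℤ) : DA (-k) = DA k := by simp [DA]

/-- Theta quotients. -/
noncomputable def B1 : A := Pi' 5 25 * Pi' 20 25
/-- Theta quotients. -/
noncomputable def B2 : A := Pi' 10 25 * Pi' 15 25
/-- Theta quotients. -/
noncomputable def Q2 : A := Pi' 25 25 * Pi' 25 25

theorem hasProd_pos (d e : ℕ) (hd : 0 < d) (he : 0 < e) (h : d + e = 5) :
    HasProd (fun k : ℤ => DA (5 * k + d)) (Pi' (5 * d) 25 * Pi' (5 * e) 25) := by
  apply HasProd.of_nat_of_neg_add_one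
  · have : HasProd (fun i : ℕ => (1 : A) - X ^ (5 * d + 25 * i)) (Pi' (5 * d) 25) := (multipliable_P (5 * d) 25 (by norm_num)).hasProd
    convert this using 1
    funext n
    rw [DA, if_neg (by omega)]
    congr 2; omega
  · have : HasProd (fun i : ℕ => (1 : A) - X ^ (5 * e + 25 * i)) (Pi' (5 * e) 25) := (multipliable_P (5 * e) 25 (by norm_num)).hasProd
    convert this using 1
    funext n
    rw [DA, if_neg (by omega)]
    congr 2; omega

theorem hasProd_neg {d : ℤ} {L : A} (h : HasProd (fun k : ℤ => DA (5 * k + d)) L) :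
    HasProd (fun k : ℤ => DA (5 * k + -d)) L := by
  have := (Equiv.neg ℤ).hasProd_iff.2 h
  convert this using 1
  funext k
  simp only [Function.comp, Equiv.neg_apply]
  rw [← DA_neg]; congr 1; ring

theorem hasProd_zero : HasProd (fun k : ℤ => DA (5 * k + 0)) Q2 := by
  have := HasProd.of_add_one_of_neg_add_one (f := fun k : ℤ => DA (5 * k + 0)) (m := Pi' 25 25) (m' := Pi' 25 25) ?_ ?_
  · simpa [DA, Q2] using this
  · have : HasProd (fun i : ℕ => (1 : A) - X ^ (25 + 25 * i)) (Pi' 25 25) := (multipliable_P 25 25 (by norm_num)).hasProd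
    convert this using 1
    funext n
    rw [DA, if_neg (by omega)]
    congr 2; omega
  · have : HasProd (fun i : ℕ => (1 : A) - X ^ (25 + 25 * i)) (Pi' 25 25) := (multipliable_P 25 25 (by norm_num)).hasProd
    convert this using 1
    funext n
    rw [DA, if_neg (by omega)]
    congr 2; omega

/-- Limits of difference products. -/
noncomputable def Hv (d : ℤ) : A :=
  if d = 0 then Q2 else if d = 1 ∨ d = -1 ∨ d = 4 ∨ d = -4 then B1 else B2

theorem hasProd_Hv (d : ℤ) (h1 : -5 < d) (h2 : d < 5) : HasProd (fun k : ℤ => DA (5 * k + d)) (Hv d) := by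
  have p1 : HasProd (fun k : ℤ => DA (5 * k + 1)) B1 := hasProd_pos 1 4 (by norm_num) (by norm_num) rfl
  have p2 : HasProd (fun k : ℤ => DA (5 * k + 2)) B2 := hasProd_pos 2 3 (by norm_num) (by norm_num) rfl
  have p3 : HasProd (fun k : ℤ => DA (5 * k + 3)) B2 := by
    rw [B2, mul_comm]; exact hasProd_pos 3 2 (by norm_num) (by norm_num) rfl
  have p4 : HasProd (fun k : ℤ => DA (5 * k + 4)) B1 := by
    rw [B1, mul_comm]; exact hasProd_pos 4 1 (by norm_num) (by norm_num) rfl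
  have p0 := hasProd_zero
  have p0' : HasProd (fun k : ℤ => DA (5 * k)) Q2 := by simpa using p0
  have n1 := hasProd_neg p1
  have n2 := hasProd_neg p2
  have n3 := hasProd_neg p3
  have n4 := hasProd_neg p4
  interval_cases d <;> simp only [Hv] <;> norm_num <;> simpa using ‹_›

theorem tendsto_I : Tendsto (fun N : ℕ => Finset.Ico (-(N : ℤ)) N) atTop atTop := by
  apply tendsto_atTop_finset_of_monotone
  · intro a b hab
    apply Finset.Ico_subset_Ico <;> omega
  · intro x
    exact ⟨x.natAbs + 1, by rw [Finset.mem_Ico]; omega⟩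

theorem tendsto_DA (m s s' : ℤ) (h1 : -5 < s - s') (h2 : s - s' < 5) :
    Tendsto (fun N : ℕ => ∏ m' ∈ Finset.Ico (-(N : ℤ)) N, DA ((5 * m + s) - (5 * m' + s'))) atTop (𝓝 (Hv (s - s'))) := by
  have h := (Equiv.subLeft m).hasProd_iff.2 (hasProd_Hv (s - s') h1 h2)
  have h3 := Tendsto.comp h tendsto_I
  refine h3.congr ?_
  intro N
  simp only [Function.comp, Equiv.subLeft_apply]
  apply Finset.prod_congr rfl
  intro m' _
  congr 1; ring

theorem dvd_tau (b : ℕ) (i : ℤ) : (X : A) ^ i.natAbs ∣ tau b i := by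
  rw [tau]
  split_ifs
  · apply Dvd.dvd.mul_right
    apply Dvd.dvd.mul_left
    exact pow_dvd_pow _ (by rw [ex]; omega)
  · rw [dvd_neg]
    apply Dvd.dvd.mul_right
    apply Dvd.dvd.mul_left
    exact pow_dvd_pow _ (by rw [ex]; omega)

theorem tendsto_natAbs : Tendsto Int.natAbs cofinite atTop := by
  rw [tendsto_atTop]
  intro b
  show {p : ℤ | ¬ (b ≤ p.natAbs)}.Finite
  apply (Set.finite_Icc (-(b : ℤ)) b).subset
  intro x h
  simp at h ⊢
  omega

/-- Bilateral sums over residue classes. -/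
noncomputable def BB (b : ℕ) (s : ℤ) : A := ∑' m : ℤ, tau b (5 * m + s)

theorem hasSum_BB (b : ℕ) (s : ℤ) (h1 : 0 ≤ s) (h2 : s < 5) : HasSum (fun m : ℤ => tau b (5 * m + s)) (BB b s) := by
  apply Summable.hasSum
  apply summable_of_dvd tendsto_natAbs
  intro m
  exact (pow_dvd_pow _ (by omega)).trans (dvd_tau b _)

theorem lag_lim (T : Finset ℤ)
    (hT : ∀ s ∈ T, 0 < s ∧ s < 5) (hcard : T.card = 3) (c : ℕ) (hc : c ≤ 1) (b : ℕ) (u : ℤ → A)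
    (hu : ∀ s ∈ T, ∀ m : ℤ, ph X ^ 4 * ((ph X ^ 5) ^ (c * (5 * m + s)) *
      (∏ s' ∈ T, ((-1) ^ (Mf (5 * m + s) s') * (ph X ^ 5) ^ (Mf (5 * m + s) s' * (5 * m + s) - Gf s' (Mf (5 * m + s) s'))))
       / ((ph X ^ 5) ^ (5 * m + s) - 1)) = ph (u s * tau b (5 * m + s))) :
    X ^ 4 * (∏ s' ∈ T, Hv (0 - s'))⁻¹ + ∑ s ∈ T, u s * BB b s * (∏ s' ∈ T, Hv (s - s'))⁻¹ = 0 := by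
  have hcc : ∀ (i : ℤ) (N : ℕ), constantCoeff (∏ s' ∈ T, ∏ m' ∈ Finset.Ico (-(N : ℤ)) N, DA (i - (5 * m' + s'))) = 1 := by
    intro i N; simp only [map_prod, cc_DA, Finset.prod_const_one]
  have hP : ∀ s m : ℤ, 0 ≤ s → s < 5 → Tendsto (fun N : ℕ => (∏ s' ∈ T, ∏ m' ∈ Finset.Ico (-(N : ℤ)) N,
      DA ((5 * m + s) - (5 * m' + s')))⁻¹) atTop (𝓝 (∏ s' ∈ T, Hv (s - s'))⁻¹) := by
    intro s m h1 h2
    have h3 : Tendsto (fun N : ℕ => (∏ s' ∈ T, ∏ m' ∈ Finset.Ico (-(N : ℤ)) N,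
      DA ((5 * m + s) - (5 * m' + s')))) atTop (𝓝 (∏ s' ∈ T, Hv (s - s'))) := by
      apply tendsto_finsetProd
      intro s' hs'
      have := hT s' hs'
      exact tendsto_DA m s s' (by omega) (by omega)
    exact tendsto_inv' h3 (fun N => hcc _ N) (cc_of_tendsto h3 (fun N => hcc _ N))
  have hlim : Tendsto (fun N : ℕ => X ^ 4 * (∏ s' ∈ T, ∏ m' ∈ Finset.Ico (-(N : ℤ)) N, DA (0 - (5 * m' + s')))⁻¹ +
    ∑ s ∈ T, ∑ m ∈ Finset.Ico (-(N : ℤ)) N, (u s * tau b (5 * m + s)) *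
      (∏ s' ∈ T, ∏ m' ∈ Finset.Ico (-(N : ℤ)) N, DA ((5 * m + s) - (5 * m' + s')))⁻¹) atTop
      (𝓝 (X ^ 4 * (∏ s' ∈ T, Hv (0 - s'))⁻¹ + ∑ s ∈ T, u s * BB b s * (∏ s' ∈ T, Hv (s - s'))⁻¹)) := by
    apply Tendsto.add
    · have := (hP 0 0 le_rfl (by norm_num)).const_mul (X ^ 4)
      simpa only [mul_zero, zero_add] using this
    · apply tendsto_finsetSum
      intro s hs
      have hs' := hT s hs
      have := tannery (fun N : ℕ => Finset.Ico (-(N : ℤ)) N)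
        (fun i => by filter_upwards [eventually_ge_atTop (i.natAbs + 1)] with N hN; rw [Finset.mem_Ico]; omega)
        (fun m => u s * tau b (5 * m + s)) Int.natAbs tendsto_natAbs
        (fun m => ((pow_dvd_pow _ (by omega)).trans (dvd_tau b (5 * m + s))).mul_left _) _ _
        (fun m => hP s m hs'.1.le hs'.2)
      rw [((hasSum_BB b s hs'.1.le hs'.2).mul_left (u s)).tsum_eq] at this
      exact this
  refine tendsto_nhds_unique hlim (tendsto_const_nhds.congr' ?_)
  filter_upwards [eventually_ge_atTop 1] with N hN
  exact (lagA N hN T hT hcard c hc b u hu).symm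

end Spt5

namespace Spt5

theorem hu_aux (b : ℕ) (hb : b ≤ 4) (i : ℤ) (hi : i ≠ 0) (c ku κ : ℕ) (s1 s2 s3 : ℤ) (h12 : s1 ≠ s2)
    (h13 : s1 ≠ s3) (h23 : s2 ≠ s3) (M1 M2 M3 : ℤ)
    (hM1 : Mf i s1 = M1) (hM2 : Mf i s2 = M2) (hM3 : Mf i s3 = M3)
    (h1 : 5 * (c * i + (M1 * i - Gf s1 M1) + (M2 * i - Gf s2 M2) + (M3 * i - Gf s3 M3)) + 4 = hx i + b * i + ku)
    (h2 : Even (M1 + M2 + M3 + 1 + κ - i)) :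
    ph X ^ 4 * ((ph X ^ 5) ^ (c * i) *
      (∏ s' ∈ ({s1, s2, s3} : Finset ℤ), ((-1) ^ (Mf i s') * (ph X ^ 5) ^ (Mf i s' * i - Gf s' (Mf i s'))))
       / ((ph X ^ 5) ^ i - 1)) = ph ((-1) ^ κ * X ^ ku * tau b i) := by
  rw [← term_aux b hb i hi _ _ ku κ h1 h2]
  have hX : (ph X ^ 5) ≠ 0 := pow_ne_zero _ phX_ne
  have hm : (-1 : KA) ≠ 0 := by norm_num
  rw [Finset.prod_insert (by simp [h12, h13]), Finset.prod_insert (by simp [h23]), Finset.prod_singleton,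
    hM1, hM2, hM3]
  simp only [zpow_add₀ hX, zpow_add₀ hm]
  ring

theorem id1 : X ^ 4 * (B1 * B2 * B2)⁻¹ + (X * BB 1 1 * (Q2 * B1 * B2)⁻¹ + BB 1 2 * (B1 * Q2 * B1)⁻¹
    + X * BB 1 3 * (B2 * B1 * Q2)⁻¹) = 0 := by
  have h := lag_lim {1, 2, 3} (by decide) (by decide) 0 (by norm_num) 1 (fun s => if s = 2 then 1 else X) ?_
  · rw [Finset.sum_insert (by decide), Finset.sum_insert (by decide), Finset.sum_singleton] at h
    simp only [Finset.prod_insert (show (1 : ℤ) ∉ ({2, 3} : Finset ℤ) by decide),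
      Finset.prod_insert (show (2 : ℤ) ∉ ({3} : Finset ℤ) by decide), Finset.prod_singleton] at h
    norm_num [Hv] at h
    simp only [PowerSeries.mul_inv_rev]
    linear_combination h
  · intro s hs m
    have t0 := tri2 m
    have t1 := tri2 (m + 1)
    have t2 := hx2 (5 * m + s)
    simp only [Finset.mem_insert, Finset.mem_singleton] at hs
    rcases hs with rfl | rfl | rfl
    · rw [hu_aux 1 (by norm_num) _ (by omega) 0 1 0 1 2 3 (by decide) (by decide) (by decide) m m m
        (by rw [Mf]; omega) (by rw [Mf]; omega) (by rw [Mf]; omega)]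
      · norm_num
      · simp only [Gf]; push_cast; linarith
      · exact ⟨-m, by push_cast; ring⟩
    · rw [hu_aux 1 (by norm_num) _ (by omega) 0 0 0 1 2 3 (by decide) (by decide) (by decide) (m+1) m m
        (by rw [Mf]; omega) (by rw [Mf]; omega) (by rw [Mf]; omega)]
      · norm_num
      · simp only [Gf]; push_cast; linarith
      · exact ⟨-m, by push_cast; ring⟩
    · rw [hu_aux 1 (by norm_num) _ (by omega) 0 1 0 1 2 3 (by decide) (by decide) (by decide) (m+1) (m+1) m
        (by rw [Mf]; omega) (by rw [Mf]; omega) (by rw [Mf]; omega)]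
      · norm_num
      · simp only [Gf]; push_cast; linarith
      · exact ⟨-m, by push_cast; ring⟩

theorem id2 : X ^ 4 * (B1 * B2 * B1)⁻¹ + (X ^ 3 * BB 4 1 * (Q2 * B2 * B2)⁻¹ - X ^ 2 * BB 4 3 * (B2 * Q2 * B1)⁻¹
    - X ^ 2 * BB 4 4 * (B2 * B1 * Q2)⁻¹) = 0 := by
  have h := lag_lim {1, 3, 4} (by decide) (by decide) 1 (by norm_num) 4 (fun s => if s = 1 then X ^ 3 else - X ^ 2) ?_
  · rw [Finset.sum_insert (by decide), Finset.sum_insert (by decide), Finset.sum_singleton] at h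
    simp only [Finset.prod_insert (show (1 : ℤ) ∉ ({3, 4} : Finset ℤ) by decide),
      Finset.prod_insert (show (3 : ℤ) ∉ ({4} : Finset ℤ) by decide), Finset.prod_singleton] at h
    norm_num [Hv] at h
    simp only [PowerSeries.mul_inv_rev]
    linear_combination h
  · intro s hs m
    have t0 := tri2 m
    have t1 := tri2 (m + 1)
    have t2 := hx2 (5 * m + s)
    simp only [Finset.mem_insert, Finset.mem_singleton] at hs
    rcases hs with rfl | rfl | rfl
    · rw [hu_aux 4 (by norm_num) _ (by omega) 1 3 0 1 3 4 (by decide) (by decide) (by decide) m m m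
        (by rw [Mf]; omega) (by rw [Mf]; omega) (by rw [Mf]; omega)]
      · norm_num
      · simp only [Gf]; push_cast; linarith
      · exact ⟨-m, by push_cast; ring⟩
    · rw [hu_aux 4 (by norm_num) _ (by omega) 1 2 1 1 3 4 (by decide) (by decide) (by decide) (m+1) m m
        (by rw [Mf]; omega) (by rw [Mf]; omega) (by rw [Mf]; omega)]
      · norm_num
      · simp only [Gf]; push_cast; linarith
      · exact ⟨-m, by push_cast; ring⟩
    · rw [hu_aux 4 (by norm_num) _ (by omega) 1 2 1 1 3 4 (by decide) (by decide) (by decide) (m+1) (m+1) m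
        (by rw [Mf]; omega) (by rw [Mf]; omega) (by rw [Mf]; omega)]
      · norm_num
      · simp only [Gf]; push_cast; linarith
      · exact ⟨-m, by push_cast; ring⟩

theorem cc_B1 : constantCoeff B1 = 1 := by
  rw [B1, map_mul, cc_P _ _ (by norm_num) (by norm_num), cc_P _ _ (by norm_num) (by norm_num), mul_one]
theorem cc_B2 : constantCoeff B2 = 1 := by
  rw [B2, map_mul, cc_P _ _ (by norm_num) (by norm_num), cc_P _ _ (by norm_num) (by norm_num), mul_one]
theorem cc_Q2 : constantCoeff Q2 = 1 := by
  rw [Q2, map_mul, cc_P _ _ (by norm_num) (by norm_num), mul_one]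

theorem star : J0 ^ 3 * BB 1 2 + J0 ^ 2 * J1 * X * (BB 1 1 + BB 1 3) - X ^ 3 * J1 ^ 3 * BB 4 1
    + X ^ 2 * J0 * J1 ^ 2 * (BB 4 3 + BB 4 4) = 0 := by
  have e0 : J0 = B2 * Pi' 25 25 := rfl
  have e1 : J1 = B1 * Pi' 25 25 := rfl
  have i1 := id1
  have i2 := id2
  simp only [PowerSeries.mul_inv_rev] at i1 i2
  have b1 := inv_cancel cc_B1
  have b2 := inv_cancel cc_B2
  have q2 := inv_cancel cc_Q2
  have n1 := cc_ne cc_B1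
  have n2 := cc_ne cc_B2
  have nq := cc_ne cc_Q2
  have k1 : X ^ 4 * Q2 * B1 + X * (BB 1 1 + BB 1 3) * B1 * B2 + BB 1 2 * B2 ^ 2 = 0 := by
    have : ph (X ^ 4 * Q2 * B1 + X * (BB 1 1 + BB 1 3) * B1 * B2 + BB 1 2 * B2 ^ 2) = 0 := by
      have j := congrArg ph i1
      have m1 : ph B1 ≠ 0 := by rwa [Ne, map_eq_zero_iff _ ph_inj]
      have m2 : ph B2 ≠ 0 := by rwa [Ne, map_eq_zero_iff _ ph_inj]
      have m3 : ph Q2 ≠ 0 := by rwa [Ne, map_eq_zero_iff _ ph_inj]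
      simp only [map_add, map_mul, map_pow, ph_inv cc_B1, ph_inv cc_B2, ph_inv cc_Q2, map_zero] at j ⊢
      field_simp at j
      linear_combination j
    rwa [map_eq_zero_iff _ ph_inj] at this
  have k2 : X ^ 4 * Q2 * B2 + X ^ 3 * BB 4 1 * B1 ^ 2 - X ^ 2 * (BB 4 3 + BB 4 4) * B1 * B2 = 0 := by
    have : ph (X ^ 4 * Q2 * B2 + X ^ 3 * BB 4 1 * B1 ^ 2 - X ^ 2 * (BB 4 3 + BB 4 4) * B1 * B2) = 0 := by
      have j := congrArg ph i2
      have m0 := phX_ne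
      have m1 : ph B1 ≠ 0 := by rwa [Ne, map_eq_zero_iff _ ph_inj]
      have m2 : ph B2 ≠ 0 := by rwa [Ne, map_eq_zero_iff _ ph_inj]
      have m3 : ph Q2 ≠ 0 := by rwa [Ne, map_eq_zero_iff _ ph_inj]
      simp only [map_add, map_sub, map_mul, map_pow, ph_inv cc_B1, ph_inv cc_B2, ph_inv cc_Q2, map_zero] at j ⊢
      field_simp at j
      linear_combination j
    rwa [map_eq_zero_iff _ ph_inj] at this
  rw [e0, e1]
  linear_combination (Pi' 25 25) ^ 3 * (B2 * k1 - B1 * k2)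

end Spt5

namespace Spt5

theorem tau_zero (b : ℕ) : tau b 0 = 0 := by simp [tau]

theorem frob_inv (r : ℕ) (hr : 0 < r) : (1 - (X : A) ^ (5 * r))⁻¹ = ((1 - X ^ r)⁻¹) ^ 5 := by
  symm
  apply eq_inv (cc_one_sub _ (by omega))
  have h : (1 - (X : A) ^ r) ^ 5 = 1 - X ^ (5 * r) := by
    rw [mul_comm 5 r, pow_mul]
    generalize (X : A) ^ r = w
    linear_combination (-w + 2 * w ^ 2 - 2 * w ^ 3 + w ^ 4) * five_eq_zero
  rw [← h, ← mul_pow, inv_cancel (cc_one_sub _ hr), one_pow]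

theorem hasSum_all (b : ℕ) : HasSum (fun i : ℤ => tau b i) (BB b 0 + BB b 1 + BB b 2 + BB b 3 + BB b 4) := by
  have key : ∀ s : ℤ, 0 ≤ s → s < 5 → HasSum (fun i : ℤ => if i % 5 = s then tau b i else 0) (BB b s) := by
    intro s h1 h2
    have hinj : Function.Injective (fun m : ℤ => 5 * m + s) := by intro x y h; simpa using h
    rw [← hinj.hasSum_iff]
    · convert hasSum_BB b s h1 h2 using 1
      funext m
      simp only [Function.comp]
      rw [if_pos (by omega)]
    · intro x hx
      rw [if_neg]
      intro h
      exact hx ⟨x / 5, by simp only; omega⟩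
  have := ((((key 0 (by norm_num) (by norm_num)).add (key 1 (by norm_num) (by norm_num))).add
    (key 2 (by norm_num) (by norm_num))).add (key 3 (by norm_num) (by norm_num))).add (key 4 (by norm_num) (by norm_num))
  convert this using 1
  funext i
  have h : i % 5 = 0 ∨ i % 5 = 1 ∨ i % 5 = 2 ∨ i % 5 = 3 ∨ i % 5 = 4 := by omega
  rcases h with h | h | h | h | h <;> simp [h]

theorem ES_term_tau (n : ℕ) : (-1)^(n+1) * X ^ (pent (n+1)) * (1 + X ^ (n+1)) *
    (X ^ (n+1) * ((1 - X ^ (n+1))⁻¹) ^ 2) =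
    - ((tau 4 ((n + 1 : ℕ) : ℤ) + 2 * tau 1 ((n + 1 : ℕ) : ℤ)) + (tau 4 (-((n + 1 : ℕ) : ℤ)) + 2 * tau 1 (-((n + 1 : ℕ) : ℤ)))) := by
  have hpos : (0 : ℤ) < ((n + 1 : ℕ) : ℤ) := by omega
  have hneg : ¬ (0 : ℤ) < -((n + 1 : ℕ) : ℤ) := by omega
  have hp : pent (n+1) + (n+1) = ex (n+1) := by rw [pent, ex]; ring
  have hc := inv_cancel (cc_one_sub (n+1) (Nat.succ_pos n))
  have hx : ∀ k : ℕ, (X : A) ^ (ex (n+1) + k * (n+1)) = X ^ (pent (n+1)) * X ^ (n+1) * (X ^ (n+1)) ^ k := by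
    intro k
    rw [pow_add, ← hp, pow_add, mul_comm k, pow_mul]
  simp only [tau, if_pos hpos, if_neg hneg, Int.natAbs_neg, Int.natAbs_natCast,
    frob_inv _ (Nat.succ_pos n), hx]
  generalize (X : A) ^ pent (n+1) = p
  generalize (-1 : A) ^ (n+1) = t
  generalize (X : A) ^ (n+1) = w at *
  generalize (1 - w)⁻¹ = v at *
  have h3 : v ^ 2 = (1 - w) ^ 3 * v ^ 5 := by
    have : (1 - w) ^ 3 * v ^ 5 = ((1 - w) * v) ^ 3 * v ^ 2 := by ring
    rw [this, hc]; ring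
  norm_num
  rw [h3]
  ring

theorem R_eq : E * sptS - T0 = - ((BB 4 0 + BB 4 1 + BB 4 2 + BB 4 3 + BB 4 4) +
    2 * (BB 1 0 + BB 1 1 + BB 1 2 + BB 1 3 + BB 1 4)) := by
  have h := ((hasSum_all 4).add ((hasSum_all 1).mul_left 2)).nat_add_neg
  have h2 := ((hasSum_nat_add_iff' 1).2 h).neg
  refine ES_main.unique ?_
  convert h2 using 1
  · rfl
  · funext n
    exact ES_term_tau n
  · simp [tau_zero]

theorem Sp_one : Sp 0 (1 : A) := by
  simpa using Sp_X 0

theorem Sp_cast {r s : ZMod 5} {f : A} (h : Sp r f) (e : r = s) : Sp s f := e ▸ h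

theorem Sp_neg {r : ZMod 5} {f : A} (h : Sp r f) : Sp r (-f) := by
  intro n hn; rw [map_neg, h n hn, neg_zero]

theorem hx_cast (i : ℤ) : ((hx i : ℤ) : ZMod 5) = 3 * (i * (3 * i + 1)) := by
  have h := congrArg (fun z : ℤ => (z : ZMod 5)) (hx2 i)
  push_cast at h
  have h5 : (5 : ZMod 5) = 0 := by decide
  linear_combination 3 * h - (hx i : ZMod 5) * h5

theorem Sp_tau (b : ℕ) (hb : b ≤ 4) (i : ℤ) : Sp (3 * ((i : ZMod 5) * (3 * i + 1)) + b * i) (tau b i) := by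
  have h5 : (5 : ZMod 5) = 0 := by decide
  by_cases h0 : i = 0
  · subst h0; rw [tau_zero]; intro n _; simp
  rw [← hx_cast, tau]
  split_ifs with h
  · obtain ⟨r, rfl⟩ : ∃ r : ℕ, i = r := ⟨i.natAbs, by omega⟩
    simp only [Int.natAbs_natCast]
    rw [frob_inv r (by omega), ex_hx]
    refine Sp_cast ((Sp_neg_pow r (Sp_X _)).mul (Sp_pow5 _)) ?_
    push_cast; ring
  · obtain ⟨r, rfl⟩ : ∃ r : ℕ, i = -(r : ℤ) := ⟨i.natAbs, by omega⟩
    simp only [Int.natAbs_natCast, Int.natAbs_neg]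
    rw [frob_inv r (by omega), ex_hx_neg]
    refine Sp_neg (Sp_cast ((Sp_neg_pow r (Sp_X _)).mul (Sp_pow5 _)) ?_)
    push_cast [hb]; linear_combination (r : ZMod 5) * h5

theorem Sp_BB (b : ℕ) (hb : b ≤ 4) (s : ℤ) (h1 : 0 ≤ s) (h2 : s < 5) (r : ZMod 5)
    (h : 3 * ((s : ZMod 5) * (3 * s + 1)) + b * s = r) : Sp r (BB b s) := by
  have h5 : (5 : ZMod 5) = 0 := by decide
  apply Sp_tsum (hasSum_BB b s h1 h2)
  intro m
  refine Sp_cast (Sp_tau b hb _) ?_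
  have : (((5 * m + s : ℤ)) : ZMod 5) = s := by push_cast; rw [h5]; ring
  rw [this, h]

/-- Vanishing of the coefficients in the residue class of four. -/
def NC (f : A) : Prop := ∀ n : ℕ, (n : ZMod 5) = 4 → coeff n f = 0

theorem Sp.nc {r : ZMod 5} {f : A} (h : Sp r f) (hr : r ≠ 4) : NC f := by
  intro n hn; exact h n (by rw [hn]; exact hr.symm)

theorem NC.add {f g : A} (hf : NC f) (hg : NC g) : NC (f + g) := by
  intro n hn; rw [map_add, hf n hn, hg n hn, add_zero]

theorem NC.neg {f : A} (hf : NC f) : NC (-f) := by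
  intro n hn; rw [map_neg, hf n hn, neg_zero]

theorem NC.mul {f g : A} (hf : NC f) (hg : Sp 0 g) : NC (f * g) := by
  intro n hn
  rw [coeff_mul]
  apply Finset.sum_eq_zero
  intro p hp
  rw [Finset.HasAntidiagonal.mem_antidiagonal] at hp
  by_cases h2 : (p.2 : ZMod 5) = 0
  · have : (p.1 : ZMod 5) = 4 := by
      rw [← hn, ← hp]; push_cast; rw [h2, add_zero]
    rw [hf _ this, zero_mul]
  · rw [hg _ h2, mul_zero]

theorem Sp_two : Sp 0 (2 : A) := by
  rw [← one_add_one_eq_two]; exact Sp_one.add Sp_one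

/-- Components. -/
noncomputable def g0 : A := J0 * J0 * J0
/-- Components. -/
noncomputable def g1 : A := X ^ 1 * (J0 * J0 * J1)
/-- Components. -/
noncomputable def g2 : A := X ^ 2 * (2 * (J0 * J1 * J1))
/-- Components. -/
noncomputable def g3 : A := - (X ^ 3 * (2 * (J1 * J1 * J1)))

theorem Sp_g0 : Sp 0 g0 := (Sp_J0.mul Sp_J0).mul Sp_J0
theorem Sp_g1 : Sp 1 g1 := Sp_cast ((Sp_X 1).mul ((Sp_J0.mul Sp_J0).mul Sp_J1)) (by decide)
theorem Sp_g2 : Sp 2 g2 := Sp_cast ((Sp_X 2).mul (Sp_two.mul ((Sp_J0.mul Sp_J1).mul Sp_J1))) (by decide)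
theorem Sp_g3 : Sp 3 g3 := Sp_neg (Sp_cast ((Sp_X 3).mul (Sp_two.mul ((Sp_J1.mul Sp_J1).mul Sp_J1))) (by decide))

theorem E9 : E ^ 9 = g0 + g1 + g2 + g3 := by
  have : E ^ 9 = (E ^ 3) ^ 3 := by ring
  rw [this, E_cube, g0, g1, g2, g3]
  linear_combination (-2 * X * J0 ^ 2 * J1 + 5 * X ^ 2 * J0 * J1 ^ 2 - 5 * X ^ 3 * J1 ^ 3) * five_eq_zero

theorem nc_E9 : NC (E ^ 9) := by
  rw [E9]
  exact (((Sp_g0.nc (by decide)).add (Sp_g1.nc (by decide))).add (Sp_g2.nc (by decide))).add (Sp_g3.nc (by decide))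

theorem nc_E9R : NC (E ^ 9 * (E * sptS - T0)) := by
  have w0 : Sp 0 ((BB 4 0 + BB 4 2) + 2 * (BB 1 0 + BB 1 4)) :=
    ((Sp_BB 4 (by norm_num) 0 (by norm_num) (by norm_num) 0 (by decide)).add
      (Sp_BB 4 (by norm_num) 2 (by norm_num) (by norm_num) 0 (by decide))).add
    (Sp_cast (Sp_two.mul ((Sp_BB 1 (by norm_num) 0 (by norm_num) (by norm_num) 0 (by decide)).add
      (Sp_BB 1 (by norm_num) 4 (by norm_num) (by norm_num) 0 (by decide)))) (by decide))
  have w1 : Sp 1 (BB 4 1) := Sp_BB 4 (by norm_num) 1 (by norm_num) (by norm_num) 1 (by decide)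
  have w2 : Sp 2 (BB 4 3 + BB 4 4) := (Sp_BB 4 (by norm_num) 3 (by norm_num) (by norm_num) 2 (by decide)).add
    (Sp_BB 4 (by norm_num) 4 (by norm_num) (by norm_num) 2 (by decide))
  have w3 : Sp 3 (2 * (BB 1 1 + BB 1 3)) := Sp_cast (Sp_two.mul ((Sp_BB 1 (by norm_num) 1 (by norm_num) (by norm_num) 3 (by decide)).add
    (Sp_BB 1 (by norm_num) 3 (by norm_num) (by norm_num) 3 (by decide)))) (by decide)
  have w4 : Sp 4 (2 * BB 1 2) := Sp_cast (Sp_two.mul (Sp_BB 1 (by norm_num) 2 (by norm_num) (by norm_num) 4 (by decide))) (by decide)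
  have hs := star
  have hz : g0 * (2 * BB 1 2) + g1 * (2 * (BB 1 1 + BB 1 3)) + g2 * (BB 4 3 + BB 4 4) + g3 * BB 4 1 = 0 := by
    rw [g0, g1, g2, g3]
    linear_combination 2 * hs
  have e : E ^ 9 * (E * sptS - T0) = - (
      g0 * ((BB 4 0 + BB 4 2) + 2 * (BB 1 0 + BB 1 4)) + g0 * BB 4 1 + g0 * (BB 4 3 + BB 4 4)
        + g0 * (2 * (BB 1 1 + BB 1 3))
      + g1 * ((BB 4 0 + BB 4 2) + 2 * (BB 1 0 + BB 1 4)) + g1 * BB 4 1 + g1 * (BB 4 3 + BB 4 4)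
        + g1 * (2 * BB 1 2)
      + g2 * ((BB 4 0 + BB 4 2) + 2 * (BB 1 0 + BB 1 4)) + g2 * BB 4 1 + g2 * (2 * (BB 1 1 + BB 1 3))
        + g2 * (2 * BB 1 2)
      + g3 * ((BB 4 0 + BB 4 2) + 2 * (BB 1 0 + BB 1 4)) + g3 * (BB 4 3 + BB 4 4)
        + g3 * (2 * (BB 1 1 + BB 1 3)) + g3 * (2 * BB 1 2)) := by
    rw [R_eq, E9]
    linear_combination - hz
  rw [e]
  apply NC.neg
  refine NC.add ?_ ((Sp_g3.mul w4).nc (by decide))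
  refine NC.add ?_ ((Sp_g3.mul w3).nc (by decide))
  refine NC.add ?_ ((Sp_g3.mul w2).nc (by decide))
  refine NC.add ?_ ((Sp_g3.mul w0).nc (by decide))
  refine NC.add ?_ ((Sp_g2.mul w4).nc (by decide))
  refine NC.add ?_ ((Sp_g2.mul w3).nc (by decide))
  refine NC.add ?_ ((Sp_g2.mul w1).nc (by decide))
  refine NC.add ?_ ((Sp_g2.mul w0).nc (by decide))
  refine NC.add ?_ ((Sp_g1.mul w4).nc (by decide))
  refine NC.add ?_ ((Sp_g1.mul w2).nc (by decide))
  refine NC.add ?_ ((Sp_g1.mul w1).nc (by decide))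
  refine NC.add ?_ ((Sp_g1.mul w0).nc (by decide))
  refine NC.add ?_ ((Sp_g0.mul w3).nc (by decide))
  refine NC.add ?_ ((Sp_g0.mul w2).nc (by decide))
  refine NC.add ?_ ((Sp_g0.mul w1).nc (by decide))
  exact (Sp_g0.mul w0).nc (by decide)

theorem hasSum_T0' : HasSum (fun i : ℕ => ((i : A) + 1) * (X ^ (i+1) * (1 - X ^ (i+1))⁻¹)) T0 := by
  have hs : Summable (fun p : ℕ × ℕ => ((p.1 : A) + 1) * X ^ ((p.1 + 1) * (p.2 + 1))) := by
    apply summable_of_dvd tendsto_add_cofinite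
    intro p
    apply Dvd.dvd.mul_left
    exact pow_dvd_pow _ (by nlinarith)
  have h1 := hs.hasSum
  have h3 := (Equiv.prodComm ℕ ℕ).hasSum_iff.2 h1
  have h4 := h3.prod_fiberwise (g := fun m : ℕ => X ^ (m+1) * ((1 - X ^ (m+1))⁻¹) ^ 2) (fun j => by
    have := (geom2 j).mul_left (X ^ (j+1))
    convert this using 1
    · rfl
    funext i
    simp only [Function.comp, Equiv.prodComm_apply, Prod.swap]
    rw [← pow_mul]; ring)
  rw [h4.unique hasSum_T0] at h1
  exact h1.prod_fiberwise (fun i => by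
    have := ((geom i).mul_left (X ^ (i+1))).mul_left ((i : A) + 1)
    convert this using 1
    · rfl
    funext j
    rw [← pow_mul]; ring)

/-- The Euler operator. -/
noncomputable def th (f : A) : A := X * PowerSeries.derivative (ZMod 5) f

theorem coeff_th (f : A) (n : ℕ) : coeff n (th f) = n * coeff n f := by
  rw [th]
  rcases n with _ | n
  · simp
  · rw [coeff_succ_X_mul, coeff_derivative, mul_comm]; push_cast; rfl

theorem th_mul (f g : A) : th (f * g) = f * th g + g * th f := by
  rw [th, Derivation.leibniz, th, th]
  simp only [smul_eq_mul]; ring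

theorem th_Pn (N : ℕ) : th (Pn 1 1 N) =
    - ((∑ i ∈ Finset.range N, ((i : A) + 1) * (X ^ (i+1) * (1 - X ^ (i+1))⁻¹)) * Pn 1 1 N) := by
  induction N with
  | zero => simp [Pn_zero, th]
  | succ N ih =>
    rw [Pn_succ, th_mul, ih, Finset.sum_range_succ]
    have e : 1 + 1 * N = N + 1 := by ring
    rw [e]
    have hc := inv_cancel (cc_one_sub (N+1) (Nat.succ_pos N))
    have hd : th (1 - X ^ (N+1)) = - (((N : A) + 1) * X ^ (N+1)) := by
      rw [th, map_sub, Derivation.leibniz_pow, PowerSeries.derivative_X]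
      simp
      ring
    rw [hd]
    linear_combination (((N : A) + 1) * X ^ (N+1) * Pn 1 1 N) * hc

theorem th_E : th E = - (T0 * E) := by
  have h1 : Tendsto (fun N => th (Pn 1 1 N)) atTop (𝓝 (th E)) := by
    have := tendsto_P 1 1 one_pos
    rw [tendsto_iff] at this ⊢
    intro M
    filter_upwards [this M] with N hN
    rw [X_pow_dvd_iff] at hN ⊢
    intro m hm
    have h := hN m hm
    rw [map_sub] at h
    rw [map_sub, coeff_th, coeff_th, ← mul_sub]
    exact mul_eq_zero_of_right _ h
  have h2 := (hasSum_T0'.tendsto_sum_nat.mul (tendsto_P 1 1 one_pos)).neg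
  refine tendsto_nhds_unique h1 (h2.congr ?_)
  intro N
  rw [th_Pn]

theorem th_E9 : th (E ^ 9) = E ^ 9 * T0 := by
  have h : th (E ^ 9) = 9 * E ^ 8 * th E := by
    rw [th, Derivation.leibniz_pow, th]
    simp
    ring
  rw [h, th_E]
  linear_combination (-2 * E ^ 9 * T0) * five_eq_zero

theorem nc_E9T : NC (E ^ 9 * T0) := by
  intro n hn
  rw [← th_E9, coeff_th, nc_E9 n hn, mul_zero]

theorem nc_spt : NC sptS := by
  have h1 : NC (E ^ 10 * sptS) := by
    have : E ^ 10 * sptS = E ^ 9 * (E * sptS - T0) + E ^ 9 * T0 := by ring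
    rw [this]; exact nc_E9R.add nc_E9T
  have h2 := h1.mul (Sp_pow5 (E⁻¹ ^ 2))
  have hc : E * E⁻¹ = 1 := inv_cancel (cc_P 1 1 one_pos one_pos)
  have : E ^ 10 * sptS * (E⁻¹ ^ 2) ^ 5 = (E * E⁻¹) ^ 10 * sptS := by ring
  rwa [this, hc, one_pow, one_mul] at h2

theorem main (n : ℕ) : spt (5 * n + 4) ≡ 0 [MOD 5] := by
  have h := nc_spt (5 * n + 4) (by
    push_cast
    have h5 : (5 : ZMod 5) = 0 := by decide
    rw [h5]; ring)
  rw [sptS, coeff_mk] at h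
  rw [Nat.modEq_zero_iff_dvd]
  exact (ZMod.natCast_eq_zero_iff _ _).1 h

end Spt5

end

/-- Andrews' congruence: `spt(5n+4) ≡ 0 (mod 5)`. -/
theorem spt_congr_five (n : ℕ) (hn : 1 ≤ n) : spt (5 * n + 4) ≡ 0 [MOD 5] := by
  exact Spt5.main n
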